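/- arXiv:math/0109206 — 2 statements merged into one kernel-verified Lean document; each statement's English description precedes it below -/
import Mathlib

section
/- (E^p_c ≠ E^1) Let 0 < p < 1. There is no constant C > 0 such that all f ∈ E^p satisfy ∫_ℂ e^{-π|Im z|} |Im z|^{1/p-2} |f(z)| dA(z) ≤ C ∫_ℝ |f(x)| dx; that is, the E^1-norm and the Banach-envelope norm ∫_ℂ e^{-π|Im z|} |Im z|^{1/p-2} |f(z)| dA(z) are not equivalent on E^p, so the Banach envelope of E^p is not E^1. -/
open MeasureTheory Real Complex
open scoped ENNReal NNReal

/-- An entire function of exponential type `π`. -/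
def ExpTypePi (f : ℂ → ℂ) : Prop :=
  Differentiable ℂ f ∧
    ∀ ε > 0, ∃ C > 0, ∀ z : ℂ, ‖f z‖ ≤ C * Real.exp ((Real.pi + ε) * ‖z‖)

/-- complex sinc -/
noncomputable def csinc (z : ℂ) : ℂ := dslope Complex.sin 0 z

lemma csinc_diff : Differentiable ℂ csinc := by
  have h := (Complex.differentiableOn_dslope (f := Complex.sin) (s := Set.univ) (c := 0)
    Filter.univ_mem).2 Complex.differentiable_sin.differentiableOn
  exact differentiableOn_univ.1 h

lemma csinc_mul (z : ℂ) : z * csinc z = Complex.sin z := by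
  have := sub_smul_dslope Complex.sin 0 z
  simpa [csinc] using this

lemma csin_norm_le (z : ℂ) : ‖Complex.sin z‖ ≤ Real.exp ‖z‖ := by
  have h1 : ‖Complex.exp (-z * I)‖ ≤ Real.exp ‖z‖ := by
    refine (Complex.norm_exp_le_exp_norm _).trans ?_
    simp
  have h2 : ‖Complex.exp (z * I)‖ ≤ Real.exp ‖z‖ := by
    refine (Complex.norm_exp_le_exp_norm _).trans ?_
    simp
  have h3 := norm_sub_le (Complex.exp (-z * I)) (Complex.exp (z * I))
  rw [Complex.sin, norm_div, norm_mul]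
  simp only [norm_I, Complex.norm_ofNat, mul_one]
  linarith

lemma csinc_growth : ∃ M : ℝ, 0 < M ∧ ∀ z, ‖csinc z‖ ≤ M * Real.exp ‖z‖ := by
  obtain ⟨M, hM⟩ := (isCompact_closedBall (0:ℂ) 1).exists_bound_of_continuousOn
    csinc_diff.continuous.continuousOn
  refine ⟨max M 1, by positivity, fun z => ?_⟩
  have he : 1 ≤ Real.exp ‖z‖ := Real.one_le_exp (norm_nonneg _)
  by_cases hz : ‖z‖ ≤ 1
  · have := hM z (by simpa using hz)
    have h2 := le_max_left M 1
    have h3 := le_max_right M 1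
    nlinarith
  · push Not at hz
    have h1 : ‖z‖ * ‖csinc z‖ ≤ Real.exp ‖z‖ := by
      rw [← norm_mul, csinc_mul]; exact csin_norm_le z
    have h3 := le_max_right M 1
    nlinarith [norm_nonneg (csinc z)]

lemma csinc_real (x : ℝ) : ‖csinc x‖ ≤ 1 ∧ |x| * ‖csinc x‖ ≤ 1 := by
  have key : |x| * ‖csinc x‖ = |Real.sin x| := by
    have := congrArg norm (csinc_mul (x:ℂ))
    rw [norm_mul, ← Complex.ofReal_sin, Complex.norm_real, Complex.norm_real] at this
    simpa using this
  refine ⟨?_, key ▸ Real.abs_sin_le_one x⟩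
  by_cases hx : x = 0
  · subst hx
    simp [csinc]
  · have h1 : |Real.sin x| ≤ |x| := Real.abs_sin_le_abs
    have h2 : 0 < |x| := abs_pos.2 hx
    rw [← key] at h1
    by_contra hc
    push Not at hc
    nlinarith

lemma csinc_sq (x : ℝ) : ‖csinc x‖ ^ 2 ≤ 2 * (1 + x ^ 2)⁻¹ := by
  obtain ⟨h1, h2⟩ := csinc_real x
  rw [← div_eq_mul_inv, le_div_iff₀ (by positivity)]
  have h3 : ‖csinc x‖ ^ 2 ≤ 1 := pow_le_one₀ (norm_nonneg _) h1
  have h4 : (|x| * ‖csinc x‖) ^ 2 ≤ 1 := pow_le_one₀ (by positivity) h2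
  rw [mul_pow, sq_abs] at h4
  linarith

lemma csinc_lint (t : ℝ) (ht : 0 < t) :
    ∫⁻ x : ℝ, ENNReal.ofReal (2 * (1 + (t⁻¹ * x) ^ 2)⁻¹) = ENNReal.ofReal (2 * π * t) := by
  rw [← ofReal_integral_eq_lintegral_ofReal]
  · congr 1
    rw [integral_const_mul, Measure.integral_comp_mul_left (fun x : ℝ => (1 + x ^ 2)⁻¹),
      integral_univ_inv_one_add_sq, inv_inv, abs_of_pos ht]
    simp; ring
  · exact ((integrable_inv_one_add_sq).comp_mul_left' (inv_ne_zero ht.ne')).const_mul 2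
  · exact Filter.Eventually.of_forall fun x => by positivity

noncomputable def testF (N : ℕ) (t : ℝ) (z : ℂ) : ℂ :=
  Complex.exp (-I * (π - N * t⁻¹ : ℝ) * z) * csinc ((t⁻¹ : ℝ) * z) ^ N

lemma testF_norm (N : ℕ) (t : ℝ) (z : ℂ) :
    ‖testF N t z‖ = Real.exp ((π - N * t⁻¹) * z.im) * ‖csinc ((t⁻¹ : ℝ) * z)‖ ^ N := by
  rw [testF, norm_mul, norm_pow, Complex.norm_exp]
  congr 2
  rw [mul_assoc, neg_mul, Complex.neg_re, Complex.I_mul_re, neg_neg, Complex.im_ofReal_mul]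

lemma testF_real (N : ℕ) (t : ℝ) (x : ℝ) :
    ‖testF N t x‖ = ‖csinc ((t⁻¹ * x : ℝ))‖ ^ N := by
  rw [testF_norm]; simp

lemma testF_type (N : ℕ) (t : ℝ) (ht : 0 < t) (hN : N * t⁻¹ ≤ π) : ExpTypePi (testF N t) := by
  constructor
  · unfold testF
    have := csinc_diff
    fun_prop
  · intro ε hε
    obtain ⟨M, hM0, hM⟩ := csinc_growth
    refine ⟨M ^ N, by positivity, fun z => ?_⟩
    rw [testF_norm]
    have h1 : ‖csinc ((t⁻¹ : ℝ) * z)‖ ^ N ≤ M ^ N * Real.exp (N * t⁻¹ * ‖z‖) := by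
      calc _ ≤ (M * Real.exp (t⁻¹ * ‖z‖)) ^ N := by
            refine pow_le_pow_left₀ (norm_nonneg _) ((hM _).trans_eq ?_) _
            rw [norm_mul, Complex.norm_real, Real.norm_of_nonneg (by positivity)]
        _ = _ := by rw [mul_pow, ← Real.exp_nat_mul, mul_assoc]
    have h2 : Real.exp ((π - N * t⁻¹) * z.im) ≤ Real.exp ((π - N * t⁻¹) * ‖z‖) := by
      gcongr
      exact (le_abs_self _).trans (Complex.abs_im_le_norm z)
    calc _ ≤ Real.exp ((π - N * t⁻¹) * ‖z‖) * (M ^ N * Real.exp (N * t⁻¹ * ‖z‖)) := by gcongr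
      _ = M ^ N * Real.exp (π * ‖z‖) := by
        rw [mul_left_comm, ← Real.exp_add]; congr 2; ring
      _ ≤ _ := by gcongr; linarith

lemma testF_lint (N : ℕ) (t : ℝ) (ht : 0 < t) (q : ℝ) (hq : 2 ≤ N * q) :
    ∫⁻ x : ℝ, (‖testF N t x‖₊ : ℝ≥0∞) ^ q ≤ ENNReal.ofReal (2 * π * t) := by
  rw [← csinc_lint t ht]
  refine lintegral_mono fun x => ?_
  have hq0 : 0 ≤ q := by
    by_contra h
    push Not at h
    nlinarith [(Nat.cast_nonneg N : (0:ℝ) ≤ N)]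
  have e : (‖testF N t x‖₊ : ℝ≥0∞) = ENNReal.ofReal ‖testF N t x‖ := (ofReal_norm _).symm
  rw [e, ENNReal.ofReal_rpow_of_nonneg (norm_nonneg _) hq0]
  refine ENNReal.ofReal_le_ofReal ?_
  refine le_trans ?_ (csinc_sq _)
  rw [testF_real, ← Real.rpow_natCast, ← Real.rpow_mul (norm_nonneg _), ← Real.rpow_natCast]
  exact Real.rpow_le_rpow_of_exponent_ge' (norm_nonneg _) (csinc_real _).1 (by norm_num)
    (by exact_mod_cast hq)

lemma csinc_I : csinc I ≠ 0 := by
  intro h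
  have := csinc_mul I
  rw [h, mul_zero] at this
  have h2 := Complex.sin_mul_I 1
  rw [one_mul, ← this] at h2
  have h3 : Complex.sinh 1 = 0 := by
    rcases mul_eq_zero.1 h2.symm with h | h
    · exact h
    · exact absurd h I_ne_zero
  have h4 : Real.sinh 1 = 0 := by
    rw [← Complex.ofReal_inj, Complex.ofReal_sinh]; simpa using h3
  have := Real.sinh_pos_iff.2 one_pos
  linarith

lemma lower_H (N : ℕ) (a : ℝ) : ∃ c > 0, ∃ r > 0, ∀ w ∈ Metric.ball I r, 0 < w.im ∧
    c ≤ Real.exp (-(N * w.im)) * w.im ^ a * ‖csinc w‖ ^ N := by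
  set H : ℂ → ℝ := fun w => Real.exp (-(N * w.im)) * w.im ^ a * ‖csinc w‖ ^ N with hH
  have hI : 0 < H I := by
    have := norm_pos_iff.2 csinc_I
    simp only [hH, I_im]
    positivity
  have hc : ContinuousAt H I := by
    have h1 : ContinuousAt (fun w : ℂ => w.im ^ a) I :=
      Complex.continuous_im.continuousAt.rpow_const (Or.inl (by simp))
    have h2 := csinc_diff.continuous
    have h3 : ContinuousAt (fun w : ℂ => Real.exp (-(N * w.im))) I := by fun_prop
    have h4 : ContinuousAt (fun w : ℂ => ‖csinc w‖ ^ N) I := by fun_prop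
    exact (h3.mul h1).mul h4
  have e1 := hc.eventually (lt_mem_nhds (half_lt_self hI))
  have e2 : ∀ᶠ w : ℂ in nhds I, 0 < w.im :=
    Complex.continuous_im.continuousAt.eventually (lt_mem_nhds (by simp))
  obtain ⟨r, hr, h⟩ := Metric.eventually_nhds_iff_ball.1 (e2.and e1)
  exact ⟨H I / 2, by positivity, r, hr, fun w hw => ⟨(h w hw).1, (h w hw).2.le⟩⟩

lemma envelope_lower (N : ℕ) (a c r t : ℝ) (hc : 0 < c) (hr : 0 < r) (ht : 0 < t)
    (h : ∀ w ∈ Metric.ball I r, 0 < w.im ∧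
      c ≤ Real.exp (-(N * w.im)) * w.im ^ a * ‖csinc w‖ ^ N) :
    ENNReal.ofReal (t ^ a * c * (r * t) ^ 2 * π) ≤
      ∫⁻ z : ℂ, ENNReal.ofReal (Real.exp (-Real.pi * |z.im|) * |z.im| ^ a) *
        (‖testF N t z‖₊ : ℝ≥0∞) := by
  calc _ = ∫⁻ z in Metric.ball ((t:ℂ) * I) (r * t), ENNReal.ofReal (t ^ a * c) := by
        rw [setLIntegral_const, Complex.volume_ball,
          ENNReal.ofReal_mul (by positivity), ENNReal.ofReal_mul (by positivity),
          ENNReal.ofReal_pow (by positivity), mul_assoc]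
        congr 2
        rw [← ENNReal.ofReal_coe_nnreal]; rfl
    _ ≤ ∫⁻ z in Metric.ball ((t:ℂ) * I) (r * t),
        ENNReal.ofReal (Real.exp (-Real.pi * |z.im|) * |z.im| ^ a) *
        (‖testF N t z‖₊ : ℝ≥0∞) := by
        refine setLIntegral_mono' Metric.isOpen_ball.measurableSet fun z hz => ?_
        have hw : ((t⁻¹ : ℝ) : ℂ) * z ∈ Metric.ball I r := by
          rw [mem_ball_iff_norm] at hz ⊢
          have : ((t⁻¹ : ℝ) : ℂ) * z - I = ((t⁻¹ : ℝ) : ℂ) * (z - t * I) := by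
            have : (t : ℂ) ≠ 0 := by exact_mod_cast ht.ne'
            push_cast; field_simp
          rw [this, norm_mul, Complex.norm_real, Real.norm_of_nonneg (by positivity),
            inv_mul_lt_iff₀ ht]
          linarith
        obtain ⟨h1, h2⟩ := h _ hw
        rw [Complex.im_ofReal_mul] at h1 h2
        have him : 0 < z.im := by
          by_contra hcon
          push Not at hcon
          have : 0 < t⁻¹ := by positivity
          nlinarith
        have e : (‖testF N t z‖₊ : ℝ≥0∞) = ENNReal.ofReal ‖testF N t z‖ :=
          (ofReal_norm _).symm
        rw [e, ← ENNReal.ofReal_mul (by positivity)]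
        refine ENNReal.ofReal_le_ofReal ?_
        rw [testF_norm, abs_of_pos him]
        calc t ^ a * c ≤ t ^ a * (Real.exp (-(N * (t⁻¹ * z.im))) * (t⁻¹ * z.im) ^ a *
              ‖csinc ((t⁻¹ : ℝ) * z)‖ ^ N) := by gcongr
          _ = (t * (t⁻¹ * z.im)) ^ a * Real.exp (-(N * (t⁻¹ * z.im))) *
              ‖csinc ((t⁻¹ : ℝ) * z)‖ ^ N := by
              rw [Real.mul_rpow ht.le h1.le]; ring
          _ = z.im ^ a * Real.exp (-π * z.im + (π - N * t⁻¹) * z.im) *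
              ‖csinc ((t⁻¹ : ℝ) * z)‖ ^ N := by
              rw [mul_inv_cancel_left₀ ht.ne']
              congr 3
              ring
          _ = _ := by rw [Real.exp_add]; ring
          _ ≤ _ := le_rfl
    _ ≤ _ := setLIntegral_le_lintegral _ _

/-- **`Eᵖ_c ≠ E¹`.** For `0 < p < 1` there is no constant `C > 0` bounding the
Banach-envelope norm `∫_ℂ e^{-π|Im z|} |Im z|^{1/p-2} |f(z)| dA(z)` by `C` times the
`E¹`-norm on `Eᵖ`; hence the Banach envelope of `Eᵖ` is not `E¹`. -/
theorem envelope_not_E1 (p : ℝ) (hp0 : 0 < p) (hp1 : p < 1) :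
    ¬ ∃ C : ℝ, 0 < C ∧ ∀ f : ℂ → ℂ, ExpTypePi f →
        (∫⁻ x : ℝ, (‖f x‖₊ : ℝ≥0∞) ^ p) < ⊤ →
        (∫⁻ z : ℂ, ENNReal.ofReal
            (Real.exp (-Real.pi * |z.im|) * |z.im| ^ (1 / p - 2)) * (‖f z‖₊ : ℝ≥0∞)) ≤
          ENNReal.ofReal C * ∫⁻ x : ℝ, (‖f x‖₊ : ℝ≥0∞) := by
  rintro ⟨C, hC, hall⟩
  obtain ⟨N, hN⟩ := exists_nat_ge (2 / p)
  have hNp : 2 ≤ N * p := (div_le_iff₀ hp0).1 hN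
  have hN1 : 2 ≤ (N:ℝ) * 1 := by nlinarith [(Nat.cast_nonneg N : (0:ℝ) ≤ N)]
  obtain ⟨c, hc, r, hr, h⟩ := lower_H N (1 / p - 2)
  have hb : 0 < 1 / p - 1 := by
    rw [sub_pos, lt_div_iff₀ hp0]; linarith
  have hev := ((tendsto_rpow_atTop hb).eventually_gt_atTop (C * 2 / (c * r ^ 2))).and
    (Filter.eventually_ge_atTop (max 1 (N:ℝ)))
  obtain ⟨t, ht1, ht2⟩ := hev.exists
  have ht : 0 < t := lt_of_lt_of_le one_pos ((le_max_left _ _).trans ht2)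
  have htN : N * t⁻¹ ≤ π := by
    have : N * t⁻¹ ≤ 1 := by
      rw [← div_eq_mul_inv, div_le_one ht]; exact (le_max_right _ _).trans ht2
    linarith [Real.pi_gt_three]
  have key := hall _ (testF_type N t ht htN)
    ((testF_lint N t ht p hNp).trans_lt ENNReal.ofReal_lt_top)
  have k1 := envelope_lower N (1 / p - 2) c r t hc hr ht h
  have k2 := testF_lint N t ht 1 hN1
  simp only [ENNReal.rpow_one] at k2
  have k3 := k1.trans (key.trans (mul_le_mul_right k2 _))
  rw [← ENNReal.ofReal_mul hC.le, ENNReal.ofReal_le_ofReal_iff (by positivity)] at k3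
  rw [div_lt_iff₀ (by positivity)] at ht1
  have e : t ^ (1 / p - 2) * t = t ^ (1 / p - 1) := by
    rw [← Real.rpow_add_one ht.ne']; congr 1; ring
  have e2 : t ^ (1 / p - 2) * c * (r * t) ^ 2 * π = t ^ (1 / p - 1) * (c * r ^ 2) * (t * π) := by
    rw [← e]; ring
  rw [e2] at k3
  have : 0 < t * π := by positivity
  nlinarith
end

section
/- (E^p_c ≈ ℓ^1) Let 0 < p < 1 and let Z denote the space of entire functions f with ‖f‖_Z = ∫_ℂ e^{-π|Im z|} |Im z|^{1/p-2} |f(z)| dA(z) < ∞. Then Z is isomorphic to ℓ^1: there exist a linear bijection T : Z → ℓ^1(ℕ, ℂ) and a constant C > 0 such that C^{-1} ‖f‖_Z ≤ ‖T f‖_{ℓ^1} ≤ C ‖f‖_Z for all f ∈ Z. -/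
open MeasureTheory Real Complex
open scoped ENNReal NNReal

/-- The `Z`-norm `∫_ℂ e^{-π|Im z|} |Im z|^{1/p-2} |f(z)| dA(z)`. -/
noncomputable def ZNorm (p : ℝ) (f : ℂ → ℂ) : ℝ≥0∞ :=
  ∫⁻ z : ℂ, ENNReal.ofReal
      (Real.exp (-Real.pi * |z.im|) * |z.im| ^ (1 / p - 2)) * (‖f z‖₊ : ℝ≥0∞)

/-- Membership in `Z`: entire with finite `Z`-norm. -/
def MemZ (p : ℝ) (f : ℂ → ℂ) : Prop :=
  Differentiable ℂ f ∧ ZNorm p f < ⊤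

section Part1
open MeasureTheory Real Complex
open scoped ENNReal NNReal

/-- The space `ℓ¹(ℕ)`. -/
noncomputable abbrev E1 := lp (fun _ : ℕ => ℂ) 1

lemma mem1 {f : ℕ → ℂ} (h : Summable fun i => ‖f i‖) : Memℓp f 1 := by
  apply memℓp_gen; simpa using h

lemma sum1 (f : E1) : Summable fun i => ‖f i‖ := by
  have := (lp.memℓp f).summable (by simp); simpa using this

lemma norm1 (f : E1) : ‖f‖ = ∑' i, ‖f i‖ := by
  have := lp.norm_eq_tsum_rpow (p := 1) (by simp) f; simpa using this

/-- block `i` of a sequence -/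
noncomputable def blk (i : ℕ) : E1 →ₗ[ℂ] E1 where
  toFun a := ⟨fun j => a (Nat.pair i j), mem1 (by
    have := (sum1 a).comp_injective (i := fun j => Nat.pair i j) (by
      intro x y h; simpa using h)
    exact this)⟩
  map_add' a b := by ext j; rfl
  map_smul' c a := by ext j; rfl

@[simp] lemma blk_apply (i : ℕ) (a : E1) (j : ℕ) : (blk i a) j = a (Nat.pair i j) := rfl

lemma summable_pair_iff (g : ℕ × ℕ → ℝ) :
    Summable (fun n => g (Nat.unpair n)) ↔ Summable g :=
  Nat.pairEquiv.symm.summable_iff (f := g)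

lemma tsum_pair (g : ℕ × ℕ → ℝ) : ∑' n, g (Nat.unpair n) = ∑' x, g x :=
  Nat.pairEquiv.symm.tsum_eq g

lemma blk_summable (a : E1) : Summable fun i => ‖blk i a‖ := by
  have h : Summable (fun x : ℕ × ℕ => ‖a (Nat.pair x.1 x.2)‖) := by
    rw [← summable_pair_iff]; simpa using sum1 a
  have := h.prod
  simp_rw [norm1]; exact this

lemma blk_tsum (a : E1) : ∑' i, ‖blk i a‖ = ‖a‖ := by
  have h : Summable (fun x : ℕ × ℕ => ‖a (Nat.pair x.1 x.2)‖) := by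
    rw [← summable_pair_iff]; simpa using sum1 a
  simp_rw [norm1]
  have h2 := h.tsum_prod
  simp only [blk_apply]
  rw [← h2, ← tsum_pair]; simp

lemma glue_summable (m : ℕ → E1) (h : Summable fun i => ‖m i‖) :
    Summable (fun n => ‖m (Nat.unpair n).1 (Nat.unpair n).2‖) := by
  rw [summable_pair_iff (fun x => ‖m x.1 x.2‖)]
  rw [summable_prod_of_nonneg (fun _ => norm_nonneg _)]
  refine ⟨fun i => sum1 (m i), ?_⟩
  simpa [norm1] using h

lemma glue_tsum (m : ℕ → E1) (h : Summable fun i => ‖m i‖) :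
    ∑' n, ‖m (Nat.unpair n).1 (Nat.unpair n).2‖ = ∑' i, ‖m i‖ := by
  have hs := glue_summable m h
  rw [summable_pair_iff (fun x => ‖m x.1 x.2‖)] at hs
  rw [tsum_pair (fun x => ‖m x.1 x.2‖), hs.tsum_prod]
  simp_rw [norm1]

/-- glue blocks -/
noncomputable def glue (m : ℕ → E1) (h : Summable fun i => ‖m i‖) : E1 :=
  ⟨fun n => m (Nat.unpair n).1 (Nat.unpair n).2, mem1 (glue_summable m h)⟩

lemma blk_glue (m : ℕ → E1) (h : Summable fun i => ‖m i‖) (i : ℕ) : blk i (glue m h) = m i := by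
  ext j; simp [glue]

lemma norm_glue (m : ℕ → E1) (h : Summable fun i => ‖m i‖) : ‖glue m h‖ = ∑' i, ‖m i‖ := by
  rw [norm1, ← glue_tsum m h]; rfl

lemma E1_ext_blk {a b : E1} (h : ∀ i, blk i a = blk i b) : a = b := by
  ext n
  have := congrArg (fun c : E1 => c (Nat.unpair n).2) (h (Nat.unpair n).1)
  simpa using this

/-- the component maps of the swindle -/
noncomputable def swM {V : Type*} [AddCommGroup V] [Module ℂ V]
    (A : V →ₗ[ℂ] E1) (P : E1 →ₗ[ℂ] E1) (A' : V →ₗ[ℂ] E1) (B' : E1 →ₗ[ℂ] V) : ℕ → V →ₗ[ℂ] E1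
  | 0 => A ∘ₗ (LinearMap.id - B' ∘ₗ A') + (LinearMap.id - P) ∘ₗ blk 0 ∘ₗ A'
  | (i+1) => P ∘ₗ blk i ∘ₗ A' + (LinearMap.id - P) ∘ₗ blk (i+1) ∘ₗ A'

/-- **Pelczynski decomposition** for a space `V` that is a retract of `ℓ¹` and has
`ℓ¹` as a retract. -/
theorem pelczynski {V : Type*} [AddCommGroup V] [Module ℂ V] (N : V → ℝ)
    (N0 : ∀ x, 0 ≤ N x)
    (Nadd : ∀ x y, N (x + y) ≤ N x + N y) (Nsub : ∀ x y, N (x - y) ≤ N x + N y)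
    (A : V →ₗ[ℂ] E1) (B : E1 →ₗ[ℂ] V) (A' : V →ₗ[ℂ] E1) (B' : E1 →ₗ[ℂ] V)
    (K : ℝ) (hK : 0 ≤ K)
    (hA : ∀ x, ‖A x‖ ≤ K * N x) (hA' : ∀ x, ‖A' x‖ ≤ K * N x)
    (hB : ∀ x, N (B x) ≤ K * ‖x‖) (hB' : ∀ x, N (B' x) ≤ K * ‖x‖)
    (hBA : ∀ x, B (A x) = x) (hAB : ∀ a, A' (B' a) = a) :
    ∃ (T : V →ₗ[ℂ] (ℕ → ℂ)) (C : ℝ), 0 < C ∧ Function.Injective T ∧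
      (∀ a : ℕ → ℂ, Summable (fun n => ‖a n‖) → ∃ f, T f = a) ∧
      ∀ f, Summable (fun n => ‖T f n‖) ∧ N f ≤ C * ∑' n, ‖T f n‖ ∧
        ∑' n, ‖T f n‖ ≤ C * N f := by
  set Q : V →ₗ[ℂ] V := B' ∘ₗ A' with hQ
  set P : E1 →ₗ[ℂ] E1 := A ∘ₗ (LinearMap.id - Q) ∘ₗ B with hP
  have PP : ∀ x, P (P x) = P x := by
    intro x; simp [hP, hQ, hBA, hAB]
  set c : ℝ := K * (K + K * (K * K)) with hc
  have c0 : 0 ≤ c := by positivity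
  have Pb : ∀ x, ‖P x‖ ≤ c * ‖x‖ := by
    intro x
    have h1 : N (B x - B' (A' (B x))) ≤ K * ‖x‖ + K * (K * (K * ‖x‖)) := by
      refine (Nsub _ _).trans (add_le_add (hB x) ((hB' _).trans ?_))
      have := (hA' (B x)).trans (mul_le_mul_of_nonneg_left (hB x) hK)
      exact mul_le_mul_of_nonneg_left this hK
    have := (hA (B x - B' (A' (B x)))).trans (mul_le_mul_of_nonneg_left h1 hK)
    have h2 : P x = A (B x - B' (A' (B x))) := by simp [hP, hQ]
    rw [h2]; refine this.trans (le_of_eq ?_); rw [hc]; ring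
  have Pb' : ∀ x, ‖x - P x‖ ≤ (1 + c) * ‖x‖ := by
    intro x
    have := norm_sub_le x (P x); have := Pb x; linarith
  set M := swM A P A' B' with hM
  have M0 : ∀ z, M 0 z = A (z - B' (A' z)) + (blk 0 (A' z) - P (blk 0 (A' z))) := by
    intro z; simp [hM, swM]
  have MS : ∀ i z, M (i+1) z = P (blk i (A' z)) + (blk (i+1) (A' z) - P (blk (i+1) (A' z))) := by
    intro i z; simp [hM, swM]
  have blks : ∀ z, Summable fun i => ‖blk i (A' z)‖ := fun z => blk_summable _
  have bb : ∀ i z, ‖M (i+1) z‖ ≤ c * ‖blk i (A' z)‖ + (1 + c) * ‖blk (i+1) (A' z)‖ := by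
    intro i z; rw [MS]
    exact (norm_add_le _ _).trans (add_le_add (Pb _) (Pb' _))
  have sumM1 : ∀ z, Summable fun i => ‖M (i+1) z‖ := fun z =>
    Summable.of_nonneg_of_le (fun _ => norm_nonneg _) (fun i => bb i z)
      (((blks z).mul_left c).add ((((summable_nat_add_iff 1).2 (blks z))).mul_left (1 + c)))
  have sumM : ∀ z, Summable fun i => ‖M i z‖ := fun z => (summable_nat_add_iff 1).1 (sumM1 z)
  have tsM : ∀ z, ∑' i, ‖M i z‖ ≤ (K * (1 + K * K) + (1 + c) * K + (c * K + (1 + c) * K)) * N z := by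
    intro z
    rw [(sumM z).tsum_eq_zero_add]
    have hA'z := hA' z
    have h0 : ‖M 0 z‖ ≤ K * (1 + K * K) * N z + (1 + c) * (K * N z) := by
      rw [M0]
      refine (norm_add_le _ _).trans (add_le_add ?_ ((Pb' _).trans ?_))
      · have h1 : N (z - B' (A' z)) ≤ N z + K * (K * N z) :=
          (Nsub _ _).trans (add_le_add le_rfl ((hB' _).trans (mul_le_mul_of_nonneg_left hA'z hK)))
        refine (hA _).trans ((mul_le_mul_of_nonneg_left h1 hK).trans (le_of_eq (by ring)))
      · refine mul_le_mul_of_nonneg_left (le_trans ?_ hA'z) (by positivity)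
        rw [← blk_tsum (A' z)]
        exact (blks z).le_tsum 0 (fun _ _ => norm_nonneg _)
    have h1 : ∑' i, ‖M (i+1) z‖ ≤ c * (K * N z) + (1 + c) * (K * N z) := by
      have s1 := (blks z).mul_left c
      have s2 := (((summable_nat_add_iff 1).2 (blks z))).mul_left (1 + c)
      refine ((sumM1 z).tsum_le_tsum (fun i => bb i z) (s1.add s2)).trans ?_
      rw [s1.tsum_add s2, tsum_mul_left, tsum_mul_left]
      have e1 : ∑' i, ‖blk i (A' z)‖ ≤ K * N z := by rw [blk_tsum]; exact hA'z
      have e2 : ∑' i, ‖blk (i+1) (A' z)‖ ≤ K * N z := by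
        refine le_trans ?_ e1
        rw [(blks z).tsum_eq_zero_add]; linarith [norm_nonneg (blk 0 (A' z))]
      gcongr
    nlinarith
  -- reconstruction
  have rec0 : ∀ z, P (M 0 z) = A (z - B' (A' z)) := by
    intro z; 
    have e : P (A (z - B' (A' z))) = A (z - B' (A' z)) := by simp [hP, hQ, hBA, hAB]
    rw [M0, map_add, e, map_sub P, PP, sub_self, add_zero]
  have PMS : ∀ i z, P (M (i+1) z) = P (blk i (A' z)) := by
    intro i z; rw [MS]; simp [PP]
  have recl : ∀ i z, blk i (A' z) = (M i z - P (M i z)) + P (M (i+1) z) := by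
    intro i z
    rw [PMS]
    cases i with
    | zero => rw [rec0, M0]; abel
    | succ i => rw [PMS, MS]; abel
  have recz : ∀ z, z = B (P (M 0 z)) + B' (A' z) := by
    intro z; rw [rec0, hBA]; abel
  have bl : ∀ z, ‖A' z‖ ≤ ((1 + c) + c) * ∑' i, ‖M i z‖ := by
    intro z
    rw [← blk_tsum]
    have s1 := (sumM z).mul_left (1 + c)
    have s2 := (sumM1 z).mul_left c
    refine ((blks z).tsum_le_tsum (fun i => ?_) (s1.add s2)).trans ?_
    · show _ ≤ (1 + c) * ‖M i z‖ + c * ‖M (i+1) z‖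
      rw [recl]; exact (norm_add_le _ _).trans (add_le_add (Pb' _) (Pb _))
    · rw [s1.tsum_add s2, tsum_mul_left, tsum_mul_left, add_mul (1+c)]
      have : ∑' i, ‖M (i+1) z‖ ≤ ∑' i, ‖M i z‖ := by
        rw [(sumM z).tsum_eq_zero_add]; linarith [norm_nonneg (M 0 z)]
      gcongr
  have low : ∀ z, N z ≤ (K * c + K * ((1 + c) + c)) * ∑' i, ‖M i z‖ := by
    intro z
    have h0 : ‖M 0 z‖ ≤ ∑' i, ‖M i z‖ := (sumM z).le_tsum 0 (fun _ _ => norm_nonneg _)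
    calc N z = N (B (P (M 0 z)) + B' (A' z)) := by rw [← recz z]
      _ ≤ K * (c * ∑' i, ‖M i z‖) + K * (((1 + c) + c) * ∑' i, ‖M i z‖) := by
        refine (Nadd _ _).trans (add_le_add ((hB _).trans ?_) ((hB' _).trans ?_))
        · gcongr; exact (Pb _).trans (by gcongr)
        · gcongr; exact bl z
      _ = _ := by ring
  let T : V →ₗ[ℂ] (ℕ → ℂ) :=
    { toFun := fun z n => M (Nat.unpair n).1 z (Nat.unpair n).2
      map_add' := by intro x y; ext n; simp
      map_smul' := by intro x y; ext n; simp }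
  have Tglue : ∀ z n, T z n = glue (fun i => M i z) (sumM z) n := fun z n => rfl
  have Tsum : ∀ z, ∑' n, ‖T z n‖ = ∑' i, ‖M i z‖ := fun z => by
    rw [← glue_tsum (fun i => M i z) (sumM z)]; rfl
  obtain ⟨C, hC⟩ : ∃ C, C = max 1 (max (K * (1 + K * K) + (1 + c) * K + (c * K + (1 + c) * K))
    (K * c + K * ((1 + c) + c))) := ⟨_, rfl⟩
  refine ⟨T, C, by rw [hC]; exact lt_of_lt_of_le one_pos (le_max_left _ _), ?_, ?_, ?_⟩
  · intro x y hxy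
    have h : ∀ i, M i x = M i y := by
      intro i
      ext j
      have := congrFun hxy (Nat.pair i j)
      simpa [T] using this
    have hl : A' x = A' y := E1_ext_blk fun i => by rw [recl, recl, h, h]
    rw [recz x, recz y, h, hl]
  · intro a ha
    let a' : E1 := ⟨a, mem1 ha⟩
    let m : ℕ → E1 := fun i => blk i a'
    have hm : Summable fun i => ‖m i‖ := blk_summable a'
    have hl : Summable fun i => ‖(m i - P (m i)) + P (m (i+1))‖ := by
      refine Summable.of_nonneg_of_le (fun _ => norm_nonneg _)
        (fun i => (norm_add_le _ _).trans (add_le_add (Pb' _) (Pb _)))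
        ((hm.mul_left (1 + c)).add (((summable_nat_add_iff 1).2 hm).mul_left c))
    let l := glue _ hl
    let w := B (m 0) - B' (A' (B (m 0)))
    have hw : A' w = 0 := by simp [w, hAB]
    have hAw : A w = P (m 0) := by simp [w, hP, hQ]
    refine ⟨w + B' l, ?_⟩
    have e1 : A' (w + B' l) = l := by rw [map_add, hw, hAB, zero_add]
    have e2 : ∀ i, blk i l = (m i - P (m i)) + P (m (i+1)) := fun i => blk_glue _ hl i
    have e3 : ∀ i, P (blk i l) = P (m (i+1)) := by intro i; rw [e2]; simp [PP]
    have e4 : ∀ i, M i (w + B' l) = m i := by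
      intro i
      cases i with
      | zero => rw [M0, e1, e3, e2, add_sub_cancel_right, hAw]; abel
      | succ i => rw [MS, e1, e3, e3, e2]; abel
    ext n
    show M (Nat.unpair n).1 (w + B' l) (Nat.unpair n).2 = a n
    rw [e4]
    show a (Nat.pair (Nat.unpair n).1 (Nat.unpair n).2) = a n
    rw [Nat.pair_unpair]
  · intro f
    refine ⟨glue_summable (fun i => M i f) (sumM f), ?_, ?_⟩
    · rw [Tsum]
      refine (low f).trans (mul_le_mul_of_nonneg_right ?_ (tsum_nonneg fun _ => norm_nonneg _))
      rw [hC]; exact le_trans (le_max_right _ _) (le_max_right _ _)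
    · rw [Tsum]
      refine (tsM f).trans (mul_le_mul_of_nonneg_right ?_ (N0 f))
      rw [hC]; exact le_trans (le_max_left _ _) (le_max_right _ _)

end Part1

section Part2
open MeasureTheory Real Complex
open scoped ENNReal NNReal

/-- The weight. -/
noncomputable def wt (s : ℝ) (z : ℂ) : ℝ := Real.exp (-Real.pi * |z.im|) * |z.im| ^ s

/-- The norm with exponent `s`. -/
noncomputable def ZN (s : ℝ) (f : ℂ → ℂ) : ℝ≥0∞ := ∫⁻ z : ℂ, ENNReal.ofReal (wt s z) * ‖f z‖ₑ

lemma wt_nonneg (s : ℝ) (z : ℂ) : 0 ≤ wt s z := by unfold wt; positivity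

lemma measurable_wt (s : ℝ) : Measurable (wt s) := by
  unfold wt
  have : Measurable fun z : ℂ => |z.im| := (Complex.measurable_im).abs
  exact ((this.const_mul _).exp).mul (this.pow_const s)

lemma circle_bound {g : ℂ → ℂ} (hg : Differentiable ℂ g) {c z : ℂ} {r δ : ℝ}
    (hz : z ∈ Metric.ball c r) (hδ : 0 < δ) (hd : ∀ θ, δ ≤ ‖circleMap c r θ - z‖) :
    ENNReal.ofReal (2 * π * δ) * ‖g z‖ₑ ≤
      ∫⁻ θ in Set.Ioo (-π) π, ENNReal.ofReal r * ‖g (circleMap c r θ)‖ₑ := by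
  have hr : 0 < r := dist_nonneg.trans_lt hz
  have h := (hg.differentiableOn (s := Metric.closedBall c r)).circleIntegral_sub_inv_smul hz
  rw [circleIntegral] at h
  set F : ℝ → ℂ := fun θ => deriv (circleMap c r) θ •
    ((circleMap c r θ - z)⁻¹ • g (circleMap c r θ)) with hF
  have hper : Function.Periodic F (2 * π) := by
    intro θ
    simp only [hF, deriv_circleMap, periodic_circleMap c r θ, periodic_circleMap 0 r θ]
  have e1 := hper.intervalIntegral_add_eq 0 (-π)
  rw [zero_add, show -π + 2 * π = π by ring] at e1
  rw [e1, intervalIntegral.integral_of_le (by linarith [pi_pos])] at h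
  have h2 : ‖(2 * π * I : ℂ) • g z‖ₑ ≤ ∫⁻ θ in Set.Ioo (-π) π, ‖F θ‖ₑ := by
    rw [← h]
    refine (enorm_integral_le_lintegral_enorm _).trans ?_
    rw [Measure.restrict_congr_set Ioo_ae_eq_Ioc]
  have h3 : ∀ θ, ENNReal.ofReal δ * ‖F θ‖ₑ ≤ ENNReal.ofReal r * ‖g (circleMap c r θ)‖ₑ := by
    intro θ
    simp only [← ofReal_norm]
    rw [← ENNReal.ofReal_mul hδ.le, ← ENNReal.ofReal_mul hr.le]
    apply ENNReal.ofReal_le_ofReal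
    simp only [hF, norm_smul, deriv_circleMap, norm_mul, norm_inv]
    have hp : 0 < ‖circleMap c r θ - z‖ := hδ.trans_le (hd θ)
    simp only [circleMap_zero, norm_mul, norm_real, norm_exp_ofReal_mul_I, norm_I,
      Real.norm_eq_abs, abs_of_pos hr, mul_one]
    have : δ * ‖circleMap c r θ - z‖⁻¹ ≤ 1 := by
      rw [← div_eq_mul_inv, div_le_one hp]; exact hd θ
    calc _ = (δ * ‖circleMap c r θ - z‖⁻¹) * (r * ‖g (circleMap c r θ)‖) := by ring
      _ ≤ 1 * (r * ‖g (circleMap c r θ)‖) := by gcongr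
      _ = _ := one_mul _
  calc ENNReal.ofReal (2 * π * δ) * ‖g z‖ₑ
      = ENNReal.ofReal δ * ‖(2 * π * I : ℂ) • g z‖ₑ := by
        simp only [← ofReal_norm]
        rw [← ENNReal.ofReal_mul (by positivity), ← ENNReal.ofReal_mul hδ.le]
        congr 1
        simp [abs_of_pos pi_pos]; ring
    _ ≤ ENNReal.ofReal δ * ∫⁻ θ in Set.Ioo (-π) π, ‖F θ‖ₑ := by gcongr
    _ = ∫⁻ θ in Set.Ioo (-π) π, ENNReal.ofReal δ * ‖F θ‖ₑ := by
        rw [lintegral_const_mul' _ _ ENNReal.ofReal_ne_top]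
    _ ≤ _ := lintegral_mono h3

lemma polar_bound {H : ℂ → ℝ≥0∞} (hH : Measurable H) (c : ℂ) {r1 r2 : ℝ} (h0 : 0 < r1)
    (V : ℝ≥0∞)
    (hV : ∀ r ∈ Set.Ioo r1 r2, V ≤ ∫⁻ θ in Set.Ioo (-π) π, H (circleMap c r θ)) :
    ENNReal.ofReal (r1 * (r2 - r1)) * V ≤ ∫⁻ w in Metric.ball c r2, H w := by
  have e1 : ∫⁻ w in Metric.ball c r2, H w =
      ∫⁻ w, (Metric.ball c r2).indicator H (c + w) := by
    rw [lintegral_add_left_eq_self (fun w => (Metric.ball c r2).indicator H w) c,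
      lintegral_indicator measurableSet_ball]
  have mI : Measurable ((Metric.ball c r2).indicator H) := hH.indicator measurableSet_ball
  have sm : ∀ p : ℝ × ℝ, c + Complex.polarCoord.symm p = circleMap c p.1 p.2 := by
    intro p
    rw [Complex.polarCoord_symm_apply, circleMap, Complex.exp_mul_I]; simp
  rw [e1, ← Complex.lintegral_comp_polarCoord_symm]
  simp_rw [sm]
  rw [show polarCoord.target = Set.Ioi (0 : ℝ) ×ˢ Set.Ioo (-π) π from rfl,
    Measure.volume_eq_prod, ← Measure.prod_restrict]
  have cont : Continuous fun p : ℝ × ℝ => circleMap c p.1 p.2 := by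
    unfold circleMap; fun_prop
  rw [lintegral_prod _ (by
    apply Measurable.aemeasurable
    exact (measurable_fst.ennreal_ofReal).smul (mI.comp cont.measurable))]
  calc ENNReal.ofReal (r1 * (r2 - r1)) * V
      = ∫⁻ r in Set.Ioo r1 r2, ENNReal.ofReal r1 * V := by
        rw [setLIntegral_const, Real.volume_Ioo, ENNReal.ofReal_mul h0.le]; ring
    _ ≤ ∫⁻ r in Set.Ioo r1 r2, ∫⁻ θ in Set.Ioo (-π) π,
          ENNReal.ofReal r • (Metric.ball c r2).indicator H (circleMap c r θ) := by
        refine setLIntegral_mono' measurableSet_Ioo (fun r hr => ?_)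
        simp only [smul_eq_mul]
        rw [lintegral_const_mul' _ _ ENNReal.ofReal_ne_top]
        have hin : ∀ θ, (Metric.ball c r2).indicator H (circleMap c r θ) = H (circleMap c r θ) := by
          intro θ
          apply Set.indicator_of_mem
          simp [circleMap, abs_of_pos (h0.trans hr.1), hr.2]
        simp_rw [hin]
        gcongr
        · exact hr.1.le
        · exact hV r hr
    _ ≤ _ := lintegral_mono_set (fun r hr => h0.trans hr.1)

/-- mean value bound on a disc of radius `1/2` -/
lemma disc_bound {f : ℂ → ℂ} (hf : Differentiable ℂ f) (c : ℂ) :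
    ‖f c‖ₑ ≤ 16 * ∫⁻ w in Metric.ball c (1/2), ‖f w‖ₑ := by
  have h := polar_bound (H := fun w => ‖f w‖ₑ) hf.continuous.enorm.measurable c
    (r1 := 1/4) (r2 := 1/2) (by norm_num) ‖f c‖ₑ (by
      intro r hr
      have hr0 : 0 < r := by linarith [hr.1]
      have := circle_bound hf (c := c) (z := c) (r := r) (δ := r) (by simp [hr0]) hr0
        (by intro θ; simp [circleMap, abs_of_pos hr0])
      rw [lintegral_const_mul' _ _ ENNReal.ofReal_ne_top, mul_comm (2 * π),
        ENNReal.ofReal_mul hr0.le, mul_assoc] at this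
      have h2 := (ENNReal.mul_le_mul_iff_right (by simpa using hr0) ENNReal.ofReal_ne_top).1 this
      refine le_trans ?_ h2
      calc ‖f c‖ₑ = 1 * ‖f c‖ₑ := (one_mul _).symm
        _ ≤ _ := by
          gcongr
          rw [← ENNReal.ofReal_one]
          apply ENNReal.ofReal_le_ofReal
          nlinarith [pi_gt_three])
  calc ‖f c‖ₑ = 16 * (ENNReal.ofReal (1/4 * (1/2 - 1/4)) * ‖f c‖ₑ) := by
        rw [← mul_assoc]
        have : (16 : ℝ≥0∞) * ENNReal.ofReal (1/4 * (1/2 - 1/4)) = 1 := by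
          rw [← ENNReal.ofReal_ofNat, ← ENNReal.ofReal_mul (by norm_num)]; norm_num
        rw [this, one_mul]
    _ ≤ _ := by gcongr

/-- pointwise bound in strips -/
lemma strip_bound (s : ℝ) (Y : ℝ) (hY : 0 ≤ Y) :
    ∃ C : ℝ≥0, ∀ f : ℂ → ℂ, Differentiable ℂ f → ∀ z : ℂ, |z.im| ≤ Y →
      ‖f z‖ₑ ≤ C * ∫⁻ w in Metric.ball (z.re : ℂ) (Y + 2), ENNReal.ofReal (wt s w) * ‖f w‖ₑ := by
  obtain ⟨m0, hm0⟩ := exists_nat_ge s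
  set m := m0 + 1 with hm
  have hms : s ≤ m := by rw [hm]; push_cast; linarith
  set R := Y + 2 with hR
  set D : ℝ := R * ((2 * R) ^ m * (R ^ ((m : ℝ) - s) * Real.exp (π * R))) with hD
  have hRp : 0 < R := by positivity
  have hD0 : 0 ≤ D := by positivity
  refine ⟨D.toNNReal, fun f hf z hz => ?_⟩
  set T : ℂ := (z.re : ℂ) with hT
  set H : ℂ → ℝ≥0∞ := fun w => ENNReal.ofReal (R * (2 * R * |w.im|) ^ m) * ‖f w‖ₑ with hH
  have mH : Measurable H := by
    refine Measurable.mul ?_ hf.continuous.enorm.measurable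
    exact (((Complex.measurable_im.abs).const_mul _).pow_const m |>.const_mul _).ennreal_ofReal
  have h := polar_bound (H := H) mH T (r1 := Y + 1) (r2 := R) (by positivity) ‖f z‖ₑ (by
      intro r hr
      have hr0 : 0 < r := by linarith [hr.1]
      have zT : z - T = z.im * I := by
        apply Complex.ext <;> simp [hT]
      have nz : ‖z - T‖ = |z.im| := by rw [zT]; simp
      have hzb : z ∈ Metric.ball T r := by
        rw [mem_ball_iff_norm, nz]; linarith [hr.1]
      have hd : ∀ θ, 1 ≤ ‖circleMap T r θ - z‖ := by
        intro θ
        have h1 : ‖circleMap T r θ - T‖ = r := by simp [circleMap, abs_of_pos hr0]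
        have h2 := norm_sub_le (circleMap T r θ - z) (T - z)
        rw [show circleMap T r θ - z - (T - z) = circleMap T r θ - T by ring, h1, norm_sub_rev T z,
          nz] at h2
        linarith [hr.1]
      have hg : Differentiable ℂ fun w => f w * ((w - T) ^ 2 - (r : ℂ) ^ 2) ^ m := by fun_prop
      have := circle_bound hg hzb one_pos hd
      have hup : ∀ θ, ENNReal.ofReal r * ‖f (circleMap T r θ) *
          ((circleMap T r θ - T) ^ 2 - (r : ℂ) ^ 2) ^ m‖ₑ ≤ H (circleMap T r θ) := by
        intro θ
        set w := circleMap T r θ with hw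
        have hv : ‖w - T‖ = r := by simp [hw, circleMap, abs_of_pos hr0]
        have him : (w - T).im = w.im := by simp [hT]
        have key : (w - T) ^ 2 - (r : ℂ) ^ 2 = (w - T) * (2 * (w.im : ℂ) * I) := by
          have e : ((r : ℂ)) ^ 2 = (w - T) * (starRingEnd ℂ) (w - T) := by
            rw [Complex.mul_conj, Complex.normSq_eq_norm_sq, hv]; simp
          rw [e, sq, ← mul_sub, Complex.sub_conj, him]; push_cast; ring
        have nk : ‖(w - T) ^ 2 - (r : ℂ) ^ 2‖ = r * (2 * |w.im|) := by
          rw [key, norm_mul, hv]; simp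
        simp only [hH, enorm_mul, enorm_pow]
        rw [← ofReal_norm ((w - T) ^ 2 - (r : ℂ) ^ 2), nk, ← ENNReal.ofReal_pow (by positivity)]
        rw [mul_left_comm, ← ENNReal.ofReal_mul hr0.le, mul_comm]
        have hb : r * (2 * |w.im|) ≤ 2 * R * |w.im| := by nlinarith [hr.2.le, abs_nonneg w.im]
        refine mul_le_mul_left (ENNReal.ofReal_le_ofReal ?_) _
        exact mul_le_mul hr.2.le (pow_le_pow_left₀ (by positivity) hb m) (by positivity) hRp.le
      refine le_trans ?_ (this.trans (lintegral_mono hup))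
      have lowz : 1 ≤ ‖((z - T) ^ 2 - (r : ℂ) ^ 2) ^ m‖ₑ := by
        rw [← ofReal_norm, ← ENNReal.ofReal_one]
        apply ENNReal.ofReal_le_ofReal
        rw [norm_pow]
        apply one_le_pow₀
        rw [zT, mul_pow, I_sq]
        have : ((z.im : ℂ)) ^ 2 * -1 - (r : ℂ) ^ 2 = ((-(z.im ^ 2 + r ^ 2) : ℝ) : ℂ) := by
          push_cast; ring
        rw [this, norm_real, Real.norm_eq_abs, abs_neg, abs_of_nonneg (by positivity)]
        nlinarith [hr.1, sq_nonneg z.im]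
      rw [enorm_mul]
      calc ‖f z‖ₑ = 1 * (‖f z‖ₑ * 1) := by simp
        _ ≤ _ := by
          gcongr
          rw [← ENNReal.ofReal_one]
          apply ENNReal.ofReal_le_ofReal
          nlinarith [pi_gt_three])
  have hH2 : ∀ w ∈ Metric.ball T R, H w ≤
      (D.toNNReal : ℝ≥0∞) * (ENNReal.ofReal (wt s w) * ‖f w‖ₑ) := by
    intro w hw
    simp only [hH]
    rw [← mul_assoc]
    gcongr
    rw [ENNReal.ofNNReal_toNNReal, ← ENNReal.ofReal_mul hD0]
    apply ENNReal.ofReal_le_ofReal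
    have hwi : |w.im| ≤ R := by
      have h1 := Complex.abs_im_le_norm (w - T)
      rw [mem_ball_iff_norm] at hw
      simp only [hT, sub_im, ofReal_im, sub_zero] at h1 
      exact h1.trans hw.le
    rw [hD, wt, mul_assoc R]
    gcongr R * ?_
    rw [mul_pow (2 * R), mul_assoc ((2 * R) ^ m)]
    gcongr (2 * R) ^ m * ?_
    have hexp : 1 ≤ Real.exp (π * R) * Real.exp (-π * |w.im|) := by
      rw [← Real.exp_add]; apply Real.one_le_exp
      nlinarith [pi_pos]
    rcases eq_or_lt_of_le (abs_nonneg w.im) with h0 | h0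
    · rw [← h0, hm, pow_succ, mul_zero]; positivity
    · have h1 : |w.im| ^ m = |w.im| ^ ((m : ℝ) - s) * |w.im| ^ s := by
        rw [← Real.rpow_add h0, sub_add_cancel, Real.rpow_natCast]
      rw [h1]
      calc |w.im| ^ ((m : ℝ) - s) * |w.im| ^ s ≤ R ^ ((m : ℝ) - s) * |w.im| ^ s := by
            gcongr
        _ ≤ R ^ ((m : ℝ) - s) * |w.im| ^ s * (Real.exp (π * R) * Real.exp (-π * |w.im|)) :=
            le_mul_of_one_le_right (by positivity) hexp
        _ = _ := by ring
  calc ‖f z‖ₑ = 1 * ‖f z‖ₑ := (one_mul _).symm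
    _ ≤ ENNReal.ofReal ((Y + 1) * (R - (Y + 1))) * ‖f z‖ₑ := by
        gcongr
        rw [← ENNReal.ofReal_one]; apply ENNReal.ofReal_le_ofReal
        rw [hR]; nlinarith
    _ ≤ ∫⁻ w in Metric.ball T R, H w := h
    _ ≤ ∫⁻ w in Metric.ball T R, (D.toNNReal : ℝ≥0∞) * (ENNReal.ofReal (wt s w) * ‖f w‖ₑ) :=
        setLIntegral_mono' measurableSet_ball hH2
    _ = _ := by rw [lintegral_const_mul' _ _ ENNReal.coe_ne_top]

end Part2

section Part3
open MeasureTheory Real Complex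
open scoped ENNReal NNReal

lemma ZN_integrand_measurable (s : ℝ) {f : ℂ → ℂ} (hf : Differentiable ℂ f) :
    Measurable fun z : ℂ => ENNReal.ofReal (wt s z) * ‖f z‖ₑ :=
  (measurable_wt s).ennreal_ofReal.mul hf.continuous.enorm.measurable

lemma ZN_add (s : ℝ) {f g : ℂ → ℂ} (hf : Differentiable ℂ f) :
    ZN s (f + g) ≤ ZN s f + ZN s g := by
  unfold ZN
  rw [← lintegral_add_left (ZN_integrand_measurable s hf)]
  apply lintegral_mono
  intro z
  simp only [Pi.add_apply]
  rw [← mul_add]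
  gcongr
  exact enorm_add_le _ _

lemma ZN_smul (s : ℝ) (c : ℂ) (f : ℂ → ℂ) : ZN s (c • f) = ‖c‖ₑ * ZN s f := by
  unfold ZN
  rw [← lintegral_const_mul' _ _ (by simp)]
  congr 1; ext z
  simp only [Pi.smul_apply, smul_eq_mul, enorm_mul]; ring

/-- The space `Z`. -/
def Zsub (s : ℝ) : Submodule ℂ (ℂ → ℂ) where
  carrier := {f | Differentiable ℂ f ∧ ZN s f < ⊤}
  add_mem' := by
    rintro f g ⟨hf, hf2⟩ ⟨hg, hg2⟩
    exact ⟨hf.add hg, (ZN_add s hf).trans_lt (ENNReal.add_lt_top.2 ⟨hf2, hg2⟩)⟩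
  zero_mem' := by
    refine ⟨differentiable_const 0, ?_⟩
    simp [ZN]
  smul_mem' := by
    rintro c f ⟨hf, hf2⟩
    refine ⟨hf.const_smul c, ?_⟩
    rw [ZN_smul]
    exact ENNReal.mul_lt_top (by simp) hf2

lemma strip_bound' (s : ℝ) (Y : ℝ) (hY : 0 ≤ Y) :
    ∃ C : ℝ≥0, ∀ f : ℂ → ℂ, Differentiable ℂ f → ∀ z : ℂ, |z.im| ≤ Y →
      ‖f z‖ₑ ≤ C * ZN s f := by
  obtain ⟨C, hC⟩ := strip_bound s Y hY
  refine ⟨C, fun f hf z hz => (hC f hf z hz).trans ?_⟩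
  gcongr
  exact setLIntegral_le_lintegral _ _

lemma synth_summable (s : ℝ) (g : ℕ → ℂ → ℂ) (hg : ∀ n, Differentiable ℂ (g n)) (C : ℝ≥0)
    (hC : ∀ n, ZN s (g n) ≤ C) (Y : ℝ) (hY : 0 ≤ Y) :
    ∃ K : ℝ, 0 ≤ K ∧ ∀ n, ∀ z : ℂ, |z.im| ≤ Y → ‖g n z‖ ≤ K := by
  obtain ⟨C', hC'⟩ := strip_bound' s Y hY
  refine ⟨C' * C, by positivity, fun n z hz => ?_⟩
  have := (hC' (g n) (hg n) z hz).trans (mul_le_mul_right (hC n) _)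
  rw [← ENNReal.coe_mul, enorm_le_coe] at this
  exact_mod_cast this

theorem synth (s : ℝ) (g : ℕ → ℂ → ℂ) (hg : ∀ n, Differentiable ℂ (g n)) (C : ℝ≥0)
    (hC : ∀ n, ZN s (g n) ≤ C) :
    ∃ B : E1 →ₗ[ℂ] Zsub s, (∀ (a : E1) (z : ℂ), Summable (fun n => a n * g n z)) ∧
      (∀ (a : E1) (z : ℂ), (B a).1 z = ∑' n, a n * g n z) ∧
      ∀ a : E1, (ZN s (B a).1).toReal ≤ C * ‖a‖ := by
  have hs : ∀ (a : E1) (z : ℂ), Summable (fun n => a n * g n z) := by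
    intro a z
    obtain ⟨K, hK0, hK⟩ := synth_summable s g hg C hC |z.im| (abs_nonneg _)
    refine Summable.of_norm_bounded ((sum1 a).mul_right K) (fun n => ?_)
    rw [norm_mul]
    gcongr
    exact hK n z le_rfl
  have hd : ∀ a : E1, Differentiable ℂ fun z => ∑' n, a n * g n z := by
    intro a z0
    obtain ⟨K, hK0, hK⟩ := synth_summable s g hg C hC (|z0.im| + 1) (by positivity)
    have hopen : IsOpen {z : ℂ | |z.im| < |z0.im| + 1} :=
      isOpen_lt (continuous_abs.comp Complex.continuous_im) continuous_const
    have := Complex.differentiableOn_tsum_of_summable_norm (U := {z : ℂ | |z.im| < |z0.im| + 1})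
      (F := fun n z => a n * g n z) ((sum1 a).mul_right K)
      (fun n => ((hg n).const_mul _).differentiableOn) hopen (by
        intro n w hw
        rw [norm_mul]
        gcongr
        exact hK n w (le_of_lt hw))
    exact (this z0 (by simp)).differentiableAt (hopen.mem_nhds (by simp))
  have hb : ∀ a : E1, ZN s (fun z => ∑' n, a n * g n z) ≤ C * ‖a‖ₑ := by
    intro a
    calc ZN s (fun z => ∑' n, a n * g n z)
        ≤ ∫⁻ z, ∑' n, ‖a n‖ₑ * (ENNReal.ofReal (wt s z) * ‖g n z‖ₑ) := by
          apply lintegral_mono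
          intro z
          simp only
          rw [show (∑' n, ‖a n‖ₑ * (ENNReal.ofReal (wt s z) * ‖g n z‖ₑ)) =
            ENNReal.ofReal (wt s z) * ∑' n, ‖a n * g n z‖ₑ by
              rw [← ENNReal.tsum_mul_left]; congr 1; ext n; rw [enorm_mul]; ring]
          gcongr
          exact enorm_tsum_le_tsum_enorm
      _ = ∑' n, ‖a n‖ₑ * ZN s (g n) := by
          rw [lintegral_tsum (fun n => ((ZN_integrand_measurable s (hg n)).const_mul _).aemeasurable)]
          congr 1; ext n
          rw [lintegral_const_mul' _ _ (by simp)]; rfl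
      _ ≤ ∑' n, ‖a n‖ₑ * C := by gcongr with n; exact hC n
      _ = C * ‖a‖ₑ := by
          rw [ENNReal.tsum_mul_right, mul_comm]
          congr 1
          rw [← ofReal_norm, norm1, ENNReal.ofReal_tsum_of_nonneg (fun _ => norm_nonneg _) (sum1 a)]
          simp
  refine ⟨{ toFun := fun a => ⟨fun z => ∑' n, a n * g n z, hd a,
      (hb a).trans_lt (ENNReal.mul_lt_top (by simp) (by simp))⟩, map_add' := ?_, map_smul' := ?_ },
      hs, fun a z => rfl, ?_⟩
  · intro a b
    ext z
    simp only [Submodule.coe_add, Pi.add_apply]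
    rw [← (hs a z).tsum_add (hs b z)]
    congr 1; ext n
    simp [add_mul]
  · intro c a
    ext z
    simp only [Submodule.coe_smul, Pi.smul_apply, RingHom.id_apply, smul_eq_mul]
    rw [← tsum_mul_left]
    congr 1; ext n
    simp [mul_assoc]
  · intro a
    have := ENNReal.toReal_mono (by finiteness) (hb a)
    simpa using this

lemma wt_compare (s : ℝ) {l w : ℂ} (hl : 1 ≤ |l.im|) (hw : w ∈ Metric.ball l (1/2)) :
    wt s l ≤ (2 : ℝ) ^ |s| * Real.exp (π / 2) * wt s w := by
  have h1 : |w.im - l.im| ≤ 1/2 := by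
    rw [mem_ball_iff_norm] at hw
    have := Complex.abs_im_le_norm (w - l)
    rw [sub_im] at this; linarith
  have h2 : |w.im| ≤ |l.im| + 1/2 := by
    have := abs_sub_abs_le_abs_sub w.im l.im; linarith
  have h3 : |l.im| ≤ |w.im| + 1/2 := by
    have := abs_sub_abs_le_abs_sub l.im w.im; rw [abs_sub_comm] at this; linarith
  have hw0 : 0 < |w.im| := by linarith
  have e1 : Real.exp (-π * |l.im|) ≤ Real.exp (π / 2) * Real.exp (-π * |w.im|) := by
    rw [← Real.exp_add]; apply Real.exp_le_exp.2; nlinarith [pi_pos]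
  have e2 : |l.im| ^ s ≤ (2 : ℝ) ^ |s| * |w.im| ^ s := by
    rcases le_total 0 s with hs | hs
    · rw [abs_of_nonneg hs, ← Real.mul_rpow (by norm_num) hw0.le]
      exact Real.rpow_le_rpow (by positivity) (by linarith) hs
    · rw [abs_of_nonpos hs]
      have : (2 * |l.im|) ^ s ≤ |w.im| ^ s :=
        Real.rpow_le_rpow_of_nonpos hw0 (by linarith) hs
      rw [Real.mul_rpow (by norm_num) (by positivity)] at this
      calc |l.im| ^ s = (2:ℝ) ^ (-s) * (2 ^ s * |l.im| ^ s) := by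
            rw [← mul_assoc, ← Real.rpow_add (by norm_num)]; simp
        _ ≤ _ := by gcongr
  unfold wt
  calc _ ≤ (Real.exp (π / 2) * Real.exp (-π * |w.im|)) * ((2 : ℝ) ^ |s| * |w.im| ^ s) := by
        gcongr
    _ = _ := by ring

theorem analysis (s : ℝ) (l : ℕ → ℂ) (hl : ∀ n, 1 ≤ |(l n).im|)
    (hsep : ∀ m n, m ≠ n → 1 ≤ dist (l m) (l n)) (c : ℕ → ℂ) (M : ℝ) (hM : 0 ≤ M)
    (hc : ∀ n, ‖c n‖ ≤ M * wt s (l n)) :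
    ∃ (A : Zsub s →ₗ[ℂ] E1) (K : ℝ), 0 ≤ K ∧ (∀ f n, A f n = c n * f.1 (l n)) ∧
      ∀ f, ‖A f‖ ≤ K * (ZN s f.1).toReal := by
  set K0 : ℝ := M * ((2 : ℝ) ^ |s| * Real.exp (π / 2)) with hK0
  have hK00 : 0 ≤ K0 := by positivity
  have hdis : Pairwise (Function.onFun Disjoint fun n => Metric.ball (l n) (1/2)) := by
    intro m n hmn
    apply Metric.ball_disjoint_ball
    have := hsep m n hmn; linarith
  have key : ∀ f : Zsub s, ∑' n, ‖c n * f.1 (l n)‖ₑ ≤ ENNReal.ofReal (16 * K0) * ZN s f.1 := by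
    intro f
    have hterm : ∀ n, ‖c n * f.1 (l n)‖ₑ ≤ ENNReal.ofReal (16 * K0) *
        ∫⁻ w in Metric.ball (l n) (1/2), ENNReal.ofReal (wt s w) * ‖f.1 w‖ₑ := by
      intro n
      rw [enorm_mul]
      calc ‖c n‖ₑ * ‖f.1 (l n)‖ₑ ≤ ‖c n‖ₑ * (16 * ∫⁻ w in Metric.ball (l n) (1/2), ‖f.1 w‖ₑ) := by
            gcongr; exact disc_bound f.2.1 _
        _ = 16 * ∫⁻ w in Metric.ball (l n) (1/2), ‖c n‖ₑ * ‖f.1 w‖ₑ := by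
            rw [lintegral_const_mul' _ _ (by simp)]; ring
        _ ≤ 16 * ∫⁻ w in Metric.ball (l n) (1/2), ENNReal.ofReal K0 *
              (ENNReal.ofReal (wt s w) * ‖f.1 w‖ₑ) := by
            gcongr 16 * ?_
            refine setLIntegral_mono' measurableSet_ball (fun w hw => ?_)
            rw [← mul_assoc]
            gcongr
            rw [← ENNReal.ofReal_mul hK00, ← ofReal_norm]
            apply ENNReal.ofReal_le_ofReal
            refine (hc n).trans ?_
            rw [hK0, mul_assoc M]
            gcongr
            exact wt_compare s (hl n) hw
        _ = _ := by
            rw [lintegral_const_mul' _ _ (by simp), ENNReal.ofReal_mul (p := 16) (by norm_num),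
              ENNReal.ofReal_ofNat, mul_assoc]
    refine (ENNReal.tsum_le_tsum hterm).trans ?_
    rw [ENNReal.tsum_mul_left, ← lintegral_iUnion (fun n => measurableSet_ball) hdis]
    gcongr
    exact setLIntegral_le_lintegral _ _
  have fin : ∀ f : Zsub s, ENNReal.ofReal (16 * K0) * ZN s f.1 ≠ ⊤ := fun f =>
    ENNReal.mul_ne_top ENNReal.ofReal_ne_top f.2.2.ne
  have hsum : ∀ f : Zsub s, Summable fun n => ‖c n * f.1 (l n)‖ := by
    intro f
    have := ne_top_of_le_ne_top (fin f) (key f)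
    simp only [← ofReal_norm] at this
    exact (ENNReal.summable_toReal this).congr (by intro n; simp)
  refine ⟨{ toFun := fun f => ⟨fun n => c n * f.1 (l n), mem1 (hsum f)⟩, map_add' := ?_, map_smul' := ?_ },
    16 * K0, by positivity, fun f n => rfl, ?_⟩
  · intro f g; ext n; simp [mul_add]; rfl
  · intro a f; ext n; simp; ring
  · intro f
    rw [norm1]
    have h := ENNReal.toReal_mono (fin f) (key f)
    rw [ENNReal.toReal_mul, ENNReal.toReal_ofReal (by positivity)] at h
    refine le_trans (le_of_eq ?_) h
    rw [ENNReal.tsum_toReal_eq (fun _ => enorm_ne_top)]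
    simp

end Part3

section Part4
open MeasureTheory Real Complex
open scoped ENNReal NNReal

lemma lint_complex {F : ℂ → ℝ≥0∞} (hF : Measurable F) :
    ∫⁻ z, F z = ∫⁻ y : ℝ, ∫⁻ x : ℝ, F (x + y * I) := by
  have h := Complex.volume_preserving_equiv_real_prod.symm
  rw [← h.lintegral_comp hF, Measure.volume_eq_prod, lintegral_prod_symm']
  · congr 1; ext y; congr 1; ext x
    congr 1
    apply Complex.ext <;> simp
  · exact hF.comp Complex.measurableEquivRealProd.symm.measurable

/-- The basic weight integral is finite. -/
lemma wint_lt_top {s : ℝ} (hs : -1 < s) {n : ℝ} (hn : |s| + 2 ≤ n) :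
    ∫⁻ y : ℝ, ENNReal.ofReal (|y| ^ s * (1 + |y|) ^ (-n)) < ⊤ := by
  have hn0 : 0 ≤ n := by have := abs_nonneg s; linarith
  have h1 : IntegrableOn (fun y : ℝ => |y| ^ s) (Set.Icc (-1) 1) := by
    have a1 : IntegrableOn (fun y : ℝ => |y| ^ s) (Set.Ioc 0 1) := by
      have := (intervalIntegral.intervalIntegrable_rpow' hs (a := 0) (b := 1))
      rw [intervalIntegrable_iff_integrableOn_Ioc_of_le zero_le_one] at this
      refine this.congr_fun (fun y hy => ?_) measurableSet_Ioc
      simp [abs_of_pos hy.1]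
    have a1' : IntegrableOn (fun y : ℝ => |y| ^ s) (Set.Icc 0 1) := by
      rwa [integrableOn_Icc_iff_integrableOn_Ioc]
    have a2 : IntegrableOn (fun y : ℝ => |y| ^ s) (Set.Icc (-1) 0) := by
      have := a1'.comp_neg
      simp only [abs_neg, Set.neg_Icc, neg_zero] at this
      exact this
    have := a2.union a1'
    rwa [Set.Icc_union_Icc_eq_Icc (by norm_num) (by norm_num)] at this
  have h2 : Integrable (fun y : ℝ => (1 + ‖y‖) ^ (-(2:ℝ))) :=
    integrable_one_add_norm (by simp)
  have h3 : ∀ y : ℝ, ENNReal.ofReal (|y| ^ s * (1 + |y|) ^ (-n)) ≤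
      (Set.Icc (-1) 1).indicator (fun y : ℝ => ENNReal.ofReal (|y| ^ s)) y +
        ENNReal.ofReal ((1 + ‖y‖) ^ (-(2:ℝ))) := by
    intro y
    by_cases hy : y ∈ Set.Icc (-1 : ℝ) 1
    · rw [Set.indicator_of_mem hy]
      refine le_add_right (ENNReal.ofReal_le_ofReal ?_)
      apply mul_le_of_le_one_right (by positivity)
      apply Real.rpow_le_one_of_one_le_of_nonpos
      · linarith [abs_nonneg y]
      · linarith
    · rw [Set.indicator_of_notMem hy, zero_add]
      apply ENNReal.ofReal_le_ofReal
      have hy1 : 1 ≤ |y| := by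
        by_contra h
        push Not at h
        exact hy ⟨(abs_lt.1 h).1.le, (abs_lt.1 h).2.le⟩
      have : |y| ^ s ≤ (1 + |y|) ^ |s| :=
        (Real.rpow_le_rpow_of_exponent_le hy1 (le_abs_self s)).trans
          (Real.rpow_le_rpow (by positivity) (by linarith) (abs_nonneg _))
      calc |y| ^ s * (1 + |y|) ^ (-n) ≤ (1 + |y|) ^ |s| * (1 + |y|) ^ (-n) := by gcongr
        _ = (1 + |y|) ^ (|s| + -n) := by rw [← Real.rpow_add (by positivity)]
        _ ≤ _ := by
          rw [Real.norm_eq_abs]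
          apply Real.rpow_le_rpow_of_exponent_le <;> linarith
  refine (lintegral_mono h3).trans_lt ?_
  rw [lintegral_add_right _ (by fun_prop), lintegral_indicator measurableSet_Icc]
  refine ENNReal.add_lt_top.2 ⟨?_, ?_⟩
  · exact h1.lintegral_lt_top
  · exact h2.lintegral_lt_top

lemma wt_add_real (s : ℝ) (z : ℂ) (t : ℝ) : wt s (z + t) = wt s z := by simp [wt]
lemma wt_sub_real (s : ℝ) (z : ℂ) (t : ℝ) : wt s (z - t) = wt s z := by simp [wt]
lemma wt_neg (s : ℝ) (z : ℂ) : wt s (-z) = wt s z := by simp [wt]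

lemma ZN_translate (s : ℝ) (f : ℂ → ℂ) (t : ℝ) : ZN s (fun z => f (z - t)) = ZN s f := by
  unfold ZN
  rw [← lintegral_sub_right_eq_self (fun z => ENNReal.ofReal (wt s z) * ‖f z‖ₑ) (t : ℂ)]
  simp only [wt_sub_real]

lemma ZN_neg (s : ℝ) (f : ℂ → ℂ) : ZN s (fun z => f (-z)) = ZN s f := by
  unfold ZN
  rw [← lintegral_neg_eq_self (fun z => ENNReal.ofReal (wt s z) * ‖f z‖ₑ)]
  simp only [wt_neg]

/-- The entire function `sin w / w`. -/
noncomputable def snc : ℂ → ℂ := dslope Complex.sin 0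

lemma snc_diff : Differentiable ℂ snc := by
  rw [← differentiableOn_univ]
  exact (Complex.differentiableOn_dslope Filter.univ_mem).2 Complex.differentiable_sin.differentiableOn

lemma snc_zero : snc 0 = 1 := by simp [snc, dslope_same]

lemma snc_ne {w : ℂ} (h : w ≠ 0) : snc w = Complex.sin w / w := by
  rw [snc, dslope_of_ne _ h, slope_def_field]; simp

lemma norm_sin_le (w : ℂ) : ‖Complex.sin w‖ ≤ Real.exp |w.im| := by
  rw [Complex.sin, norm_div, norm_mul, norm_I, mul_one, Complex.norm_ofNat, div_le_iff₀ (by norm_num)]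
  refine (norm_sub_le _ _).trans ?_
  rw [Complex.norm_exp, Complex.norm_exp]
  have h1 : Real.exp ((-w * I).re) ≤ Real.exp |w.im| := by
    apply Real.exp_le_exp.2; simp [le_abs_self]
  have h2 : Real.exp ((w * I).re) ≤ Real.exp |w.im| := by
    apply Real.exp_le_exp.2; simp [neg_le_abs]
  linarith

lemma snc_bound : ∃ C : ℝ, 0 < C ∧ ∀ w, ‖snc w‖ * (1 + ‖w‖) ≤ C * Real.exp |w.im| := by
  obtain ⟨C0, hC0⟩ := (isCompact_closedBall (0:ℂ) 1).exists_bound_of_continuousOn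
    snc_diff.continuous.continuousOn
  refine ⟨max 2 (2 * C0), by positivity, fun w => ?_⟩
  have he : 1 ≤ Real.exp |w.im| := Real.one_le_exp (abs_nonneg _)
  rcases le_or_gt ‖w‖ 1 with h | h
  · have h1 := hC0 w (by simpa using h)
    have : ‖snc w‖ * (1 + ‖w‖) ≤ C0 * 2 := by
      apply mul_le_mul h1 (by linarith) (by positivity) ((norm_nonneg _).trans h1)
    calc _ ≤ C0 * 2 := this
      _ ≤ max 2 (2 * C0) * 1 := by rw [mul_one, mul_comm]; exact le_max_right _ _
      _ ≤ _ := by gcongr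
  · have hw : w ≠ 0 := by rintro rfl; simp at h; linarith
    have hp : 0 < ‖w‖ := by linarith
    rw [snc_ne hw, norm_div]
    calc ‖Complex.sin w‖ / ‖w‖ * (1 + ‖w‖) ≤ Real.exp |w.im| / ‖w‖ * (2 * ‖w‖) := by
          gcongr
          · exact norm_sin_le w
          · linarith
      _ = 2 * Real.exp |w.im| := by field_simp
      _ ≤ _ := by gcongr; exact le_max_left _ _

lemma snc_int (k : ℤ) (hk : k ≠ 0) : snc (π * k) = 0 := by
  rw [snc_ne, mul_comm, Complex.sin_int_mul_pi, zero_div]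
  simp [hk]

lemma snc_pow_ZN {s : ℝ} (hs : -1 < s) : ∃ m : ℕ, 0 < m ∧
    ZN s (fun z => snc (π * (z - I) / m) ^ m) < ⊤ := by
  obtain ⟨n, hn⟩ := exists_nat_ge (|s| + 2)
  have hn2 : (2:ℝ) ≤ n := by linarith [abs_nonneg s]
  have hn0 : 0 < n := by
    rcases Nat.eq_zero_or_pos n with h | h
    · subst h; norm_num at hn2
    · exact h
  set m := 2 * n with hm
  have hmp : 0 < m := by omega
  have hmr : (0:ℝ) < m := by exact_mod_cast hmp
  obtain ⟨C, hC0, hC⟩ := snc_bound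
  refine ⟨m, hmp, ?_⟩
  set K : ℝ := 2 + m with hK
  set D : ℝ := (C * K) ^ m * Real.exp π with hD
  have hD0 : 0 ≤ D := by positivity
  -- pointwise bound
  have pb : ∀ x y : ℝ, ENNReal.ofReal (wt s (x + y * I)) *
      ‖snc (π * ((x + y * I : ℂ) - I) / m) ^ m‖ₑ ≤
      ENNReal.ofReal D * ENNReal.ofReal (|y| ^ s * (1 + |y|) ^ (-(n:ℝ))) *
        ENNReal.ofReal ((1 + ‖x‖) ^ (-(n:ℝ))) := by
    intro x y
    set z : ℂ := x + y * I with hz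
    have zi : z.im = y := by simp [hz]
    have zr : z.re = x := by simp [hz]
    set w : ℂ := π * (z - I) / m with hw
    have wi : w.im = π * (y - 1) / m := by
      have : w = ((π / m : ℝ) : ℂ) * (z - I) := by rw [hw]; push_cast; ring
      rw [this, Complex.im_ofReal_mul]; simp [zi]; ring
    have nw : ‖w‖ = π * ‖z - I‖ / m := by
      rw [hw]; simp [abs_of_pos pi_pos]
    have h1 : 1 + ‖z‖ ≤ K * (1 + ‖w‖) := by
      have : ‖z‖ ≤ ‖z - I‖ + 1 := by
        have := norm_add_le (z - I) I; simpa using this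
      have h3 : ‖z - I‖ ≤ m * ‖w‖ := by
        rw [nw]; field_simp; nlinarith [norm_nonneg (z - I), pi_gt_three]
      rw [hK]; nlinarith [norm_nonneg w]
    have h2 : ‖snc w‖ ^ m * (1 + ‖z‖) ^ m ≤ (C * K) ^ m * (Real.exp π * Real.exp (π * |y|)) := by
      have e1 : ‖snc w‖ * (1 + ‖z‖) ≤ (C * K) * Real.exp |w.im| := by
        calc ‖snc w‖ * (1 + ‖z‖) ≤ ‖snc w‖ * (K * (1 + ‖w‖)) := by gcongr
          _ = K * (‖snc w‖ * (1 + ‖w‖)) := by ring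
          _ ≤ K * (C * Real.exp |w.im|) := mul_le_mul_of_nonneg_left (hC w) (by positivity)
          _ = _ := by ring
      rw [← mul_pow]
      calc _ ≤ ((C * K) * Real.exp |w.im|) ^ m := by gcongr
        _ = (C * K) ^ m * Real.exp (m * |w.im|) := by rw [mul_pow, ← Real.exp_nat_mul]
        _ ≤ _ := by
          gcongr
          rw [← Real.exp_add]
          apply Real.exp_le_exp.2
          rw [wi, abs_div, abs_mul, abs_of_pos pi_pos, abs_of_pos hmr]
          have : |y - 1| ≤ |y| + 1 := by simpa using abs_sub y 1
          field_simp
          nlinarith [pi_pos]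
    have hx : 1 + |x| ≤ 1 + ‖z‖ := by have := Complex.abs_re_le_norm z; rw [zr] at this; linarith
    have hy : 1 + |y| ≤ 1 + ‖z‖ := by have := Complex.abs_im_le_norm z; rw [zi] at this; linarith
    have h3 : ((1 + |y|) ^ n * (1 + |x|) ^ n) * ‖snc w‖ ^ m ≤
        (C * K) ^ m * (Real.exp π * Real.exp (π * |y|)) := by
      refine le_trans ?_ h2
      rw [mul_comm]
      gcongr
      rw [hm, two_mul, pow_add]
      gcongr
    rw [← ofReal_norm, norm_pow, ← ENNReal.ofReal_mul (wt_nonneg _ _), ← ENNReal.ofReal_mul hD0,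
      ← ENNReal.ofReal_mul (by positivity)]
    apply ENNReal.ofReal_le_ofReal
    rw [wt, zi, Real.rpow_neg (by positivity), Real.rpow_neg (by positivity), Real.rpow_natCast,
      Real.rpow_natCast, Real.norm_eq_abs]
    have h4 : ‖snc w‖ ^ m ≤ (C * K) ^ m * (Real.exp π * Real.exp (π * |y|)) *
        (((1 + |y|) ^ n)⁻¹ * ((1 + |x|) ^ n)⁻¹) := by
      rw [← mul_inv, ← div_eq_mul_inv, le_div_iff₀ (by positivity), mul_comm]
      exact h3
    calc _ ≤ Real.exp (-π * |y|) * |y| ^ s * ((C * K) ^ m * (Real.exp π * Real.exp (π * |y|)) *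
        (((1 + |y|) ^ n)⁻¹ * ((1 + |x|) ^ n)⁻¹)) := by gcongr
      _ = (Real.exp (-π * |y|) * Real.exp (π * |y|)) * (D * (|y| ^ s * ((1 + |y|) ^ n)⁻¹) *
          ((1 + |x|) ^ n)⁻¹) := by rw [hD]; ring
      _ = _ := by rw [← Real.exp_add]; simp
  have hdiff : Differentiable ℂ fun z => snc (π * (z - I) / m) ^ m := by
    have := snc_diff
    fun_prop
  unfold ZN
  rw [lint_complex (ZN_integrand_measurable s hdiff)]
  refine (lintegral_mono fun y => lintegral_mono fun x => pb x y).trans_lt ?_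
  simp_rw [lintegral_const_mul' _ _ (ENNReal.mul_ne_top ENNReal.ofReal_ne_top ENNReal.ofReal_ne_top)]
  have hI : ∫⁻ x : ℝ, ENNReal.ofReal ((1 + ‖x‖) ^ (-(n:ℝ))) < ⊤ :=
    (integrable_one_add_norm (E := ℝ) (μ := volume) (r := n) (by rw [Module.finrank_self]; push_cast; linarith)).lintegral_lt_top
  rw [lintegral_mul_const' _ _ hI.ne, lintegral_const_mul' _ _ ENNReal.ofReal_ne_top]
  exact ENNReal.mul_lt_top (ENNReal.mul_lt_top ENNReal.ofReal_lt_top (wint_lt_top hs hn)) hI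

theorem retract {s : ℝ} (hs : -1 < s) : ∃ (A : Zsub s →ₗ[ℂ] E1) (B : E1 →ₗ[ℂ] Zsub s) (K : ℝ),
    0 ≤ K ∧ (∀ f, ‖A f‖ ≤ K * (ZN s f.1).toReal) ∧ (∀ a, (ZN s (B a).1).toReal ≤ K * ‖a‖) ∧
    ∀ a, A (B a) = a := by
  obtain ⟨m, hm, hZ⟩ := snc_pow_ZN hs
  have hm0 : (m:ℂ) ≠ 0 := by exact_mod_cast hm.ne'
  set g0 : ℂ → ℂ := fun z => snc (π * (z - I) / m) ^ m with hg0
  have hdiff : Differentiable ℂ g0 := by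
    have := snc_diff
    fun_prop
  obtain ⟨C, hC⟩ : ∃ C : ℝ≥0, (C : ℝ≥0∞) = ZN s g0 := ⟨_, ENNReal.coe_toNNReal hZ.ne⟩
  obtain ⟨B, hB1, hB2, hB3⟩ := synth s (fun k z => g0 (z - ((m * k : ℝ) : ℂ)))
    (fun k => by fun_prop) C (fun k => by rw [ZN_translate s g0, hC])
  obtain ⟨A, K, hK, hA1, hA2⟩ := analysis s (fun k => ((m * k : ℝ) : ℂ) + I) (by simp) (by
      intro a b hab
      rw [dist_add_right, Complex.dist_eq, ← ofReal_sub, norm_real, Real.norm_eq_abs, ← mul_sub,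
        abs_mul]
      have h1 : (1:ℝ) ≤ |(m:ℝ)| := by rw [abs_of_nonneg (by positivity)]; exact_mod_cast hm
      have h2 : (1:ℝ) ≤ |(a:ℝ) - b| := by
        have : (1:ℤ) ≤ |(a:ℤ) - b| := Int.one_le_abs (by omega)
        exact_mod_cast this
      nlinarith) (fun _ => 1) (Real.exp π) (by positivity) (by
        intro n
        simp only [wt]
        simp [← Real.exp_add])
  refine ⟨A, B, max K C, by positivity, fun f => (hA2 f).trans ?_, fun a => (hB3 a).trans ?_, ?_⟩
  · gcongr; exact le_max_left _ _
  · gcongr; exact le_max_right _ _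
  · intro a
    ext n
    rw [hA1, one_mul, hB2]
    have hval : ∀ k : ℕ, g0 (((m * n : ℝ) : ℂ) + I - ((m * k : ℝ) : ℂ)) = if k = n then 1 else 0 := by
      intro k
      have : (π * (((m * n : ℝ) : ℂ) + I - ((m * k : ℝ) : ℂ) - I) / m : ℂ) =
          π * (((n:ℤ) - (k:ℤ) : ℤ) : ℂ) := by
        push_cast; field_simp; ring
      simp only [hg0, this]
      split_ifs with h
      · subst h; simp [snc_zero]
      · rw [snc_int _ (by omega), zero_pow hm.ne']
    simp_rw [hval]
    simp

end Part4

section Part5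
open MeasureTheory Real Complex
open scoped ENNReal NNReal

lemma local_mass_tendsto {G : ℂ → ℝ≥0∞} (hG : Measurable G) (hfin : ∫⁻ w, G w ≠ ⊤) (R : ℝ)
    {l : Filter ℝ} [l.IsCountablyGenerated] (hl : Filter.Tendsto (fun x : ℝ => |x|) l Filter.atTop) :
    Filter.Tendsto (fun x : ℝ => ∫⁻ w in Metric.ball (x : ℂ) R, G w) l (nhds 0) := by
  have e : ∀ x : ℝ, ∫⁻ w in Metric.ball (x : ℂ) R, G w =
      ∫⁻ w, (Metric.ball (x : ℂ) R).indicator G w := fun x =>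
    (lintegral_indicator measurableSet_ball _).symm
  simp_rw [e]
  have : (0 : ℝ≥0∞) = ∫⁻ w : ℂ, (fun _ => 0) w := by simp
  rw [this]
  refine tendsto_lintegral_filter_of_dominated_convergence G
    (Filter.Eventually.of_forall fun x => hG.indicator measurableSet_ball)
    (Filter.Eventually.of_forall fun x => Filter.Eventually.of_forall fun w => ?_) hfin
    (Filter.Eventually.of_forall fun w => ?_)
  · exact Set.indicator_le_self' (by simp) w
  · apply tendsto_const_nhds.congr'
    filter_upwards [hl.eventually_gt_atTop (R + ‖w‖)] with x hx
    rw [Set.indicator_of_notMem]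
    rw [mem_ball_iff_norm']
    have := norm_sub_norm_le (x : ℂ) w
    rw [norm_real, Real.norm_eq_abs] at this
    linarith

lemma line_lint (s : ℝ) {f : ℂ → ℂ} (hf : f ∈ Zsub s) (y : ℝ) :
    ∫⁻ x : ℝ, ‖f (x + y * I)‖ₑ < ⊤ := by
  obtain ⟨C, hC⟩ := strip_bound s |y| (abs_nonneg _)
  set R := |y| + 2 with hR
  set G : ℂ → ℝ≥0∞ := fun w => ENNReal.ofReal (wt s w) * ‖f w‖ₑ with hG
  have mG : Measurable G := ZN_integrand_measurable s hf.1
  have h1 : ∀ x : ℝ, ‖f (x + y * I)‖ₑ ≤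
      C * ∫⁻ w : ℂ, {p : ℝ × ℂ | dist p.2 p.1 < R}.indicator (fun p => G p.2) (x, w) := by
    intro x
    refine (hC f hf.1 (x + y * I) (by simp)).trans ?_
    rw [← lintegral_indicator measurableSet_ball]
    gcongr with w
    have h4 : ((((x : ℂ) + y * I).re : ℝ) : ℂ) = x := by simp
    rw [h4]
    by_cases h : w ∈ Metric.ball (x : ℂ) R
    · rw [Set.indicator_of_mem h, Set.indicator_of_mem (by exact h)]
    · rw [Set.indicator_of_notMem h]; exact zero_le
  have mS : MeasurableSet {p : ℝ × ℂ | dist p.2 p.1 < R} := by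
    apply IsOpen.measurableSet
    apply isOpen_lt _ continuous_const
    fun_prop
  have mI : Measurable ({p : ℝ × ℂ | dist p.2 (p.1:ℂ) < R}.indicator (fun p => G p.2)) :=
    (mG.comp measurable_snd).indicator mS
  refine (lintegral_mono h1).trans_lt ?_
  rw [lintegral_const_mul' _ _ ENNReal.coe_ne_top, lintegral_lintegral_swap (f := fun (x : ℝ) (w : ℂ) =>
    {p : ℝ × ℂ | dist p.2 (p.1:ℂ) < R}.indicator (fun p => G p.2) (x, w)) (by exact mI.aemeasurable)]
  refine ENNReal.mul_lt_top ENNReal.coe_lt_top ?_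
  have h2 : ∀ w : ℂ, ∫⁻ x : ℝ, {p : ℝ × ℂ | dist p.2 (p.1:ℂ) < R}.indicator (fun p => G p.2) (x, w)
      ≤ ENNReal.ofReal (2 * R) * G w := by
    intro w
    calc _ ≤ ∫⁻ x : ℝ, (Metric.ball w.re R).indicator (fun _ => G w) x := by
          apply lintegral_mono
          intro x
          by_cases h : dist w (x:ℂ) < R
          · have h1 : x ∈ Metric.ball w.re R := by
              rw [Metric.mem_ball, dist_comm]
              refine lt_of_le_of_lt ?_ h
              rw [Complex.dist_eq, Real.dist_eq]
              simpa using Complex.abs_re_le_norm (w - x)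
            simp only
            rw [Set.indicator_of_mem h1, Set.indicator_of_mem (by exact h)]
          · simp only
            rw [Set.indicator_of_notMem (by exact h)]; exact zero_le
      _ = _ := by
          rw [lintegral_indicator measurableSet_ball, setLIntegral_const, Real.volume_ball, mul_comm]
  refine (lintegral_mono h2).trans_lt ?_
  rw [lintegral_const_mul' _ _ ENNReal.ofReal_ne_top]
  exact ENNReal.mul_lt_top ENNReal.ofReal_lt_top hf.2

lemma line_integrable (s : ℝ) {f : ℂ → ℂ} (hf : f ∈ Zsub s) (y : ℝ) :
    Integrable fun x : ℝ => f (x + y * I) := by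
  refine ⟨?_, line_lint s hf y⟩
  have := hf.1.continuous
  exact Continuous.aestronglyMeasurable (by fun_prop)

/-- the Fourier-type integral along the line `Im z = y` -/
noncomputable def FF (f : ℂ → ℂ) (ξ y : ℝ) : ℂ :=
  ∫ x : ℝ, f (x + y * I) * Complex.exp (-I * (x + y * I) * ξ)

lemma norm_expo (x y ξ : ℝ) : ‖Complex.exp (-I * (x + y * I) * ξ)‖ = Real.exp (y * ξ) := by
  rw [Complex.norm_exp]; congr 1; simp

lemma FF_integrable (s : ℝ) {f : ℂ → ℂ} (hf : f ∈ Zsub s) (ξ y : ℝ) :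
    Integrable fun x : ℝ => f (x + y * I) * Complex.exp (-I * (x + y * I) * ξ) := by
  refine (line_integrable s hf y).mul_bdd (c := Real.exp (y * ξ)) ?_ ?_
  · exact Continuous.aestronglyMeasurable (by fun_prop)
  · exact Filter.Eventually.of_forall fun x => (norm_expo x y ξ).le

lemma side_tendsto (s : ℝ) {f : ℂ → ℂ} (hf : f ∈ Zsub s) (ξ y1 y2 : ℝ) {l : Filter ℝ}
    [l.IsCountablyGenerated] (hl : Filter.Tendsto (fun x : ℝ => |x|) l Filter.atTop) :
    Filter.Tendsto (fun T : ℝ => ∫ y in y1..y2, f (T + y * I) * Complex.exp (-I * (T + y * I) * ξ))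
      l (nhds 0) := by
  set Y := |y1| + |y2| with hY
  obtain ⟨C, hC⟩ := strip_bound s Y (by positivity)
  have h1 := local_mass_tendsto (ZN_integrand_measurable s hf.1) hf.2.ne (Y + 2) hl
  have h2 : Filter.Tendsto (fun x : ℝ => (C * ∫⁻ w in Metric.ball (x : ℂ) (Y + 2),
      ENNReal.ofReal (wt s w) * ‖f w‖ₑ).toReal * Real.exp (Y * |ξ|) * |y2 - y1|) l (nhds 0) := by
    have := ENNReal.Tendsto.const_mul h1 (Or.inr (ENNReal.coe_ne_top (r := C)))
    rw [mul_zero] at this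
    have := (ENNReal.tendsto_toReal ENNReal.zero_ne_top).comp this
    simpa using (this.mul_const (Real.exp (Y * |ξ|))).mul_const |y2 - y1|
  refine squeeze_zero_norm (fun T => ?_) h2
  refine intervalIntegral.norm_integral_le_of_norm_le_const (fun y hy => ?_)
  have hyY : |y| ≤ Y := by
    have h3 : y ∈ Set.uIcc y1 y2 := Set.uIoc_subset_uIcc hy
    rw [hY]
    rcases Set.mem_uIcc.1 h3 with h | h <;>
    rw [abs_le] <;> constructor <;>
    linarith [neg_abs_le y1, neg_abs_le y2, le_abs_self y1, le_abs_self y2, abs_nonneg y1, abs_nonneg y2]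
  rw [norm_mul, norm_expo]
  refine mul_le_mul ?_ (Real.exp_le_exp.2 ?_) (by positivity) ENNReal.toReal_nonneg
  · have := hC f hf.1 (T + y * I) (by simpa using hyY)
    have h4 : ((T:ℂ) + y * I).re = T := by simp
    rw [h4] at this
    have hfin : C * ∫⁻ w in Metric.ball (T : ℂ) (Y + 2), ENNReal.ofReal (wt s w) * ‖f w‖ₑ ≠ ⊤ :=
      ENNReal.mul_ne_top ENNReal.coe_ne_top
        (ne_top_of_le_ne_top hf.2.ne (setLIntegral_le_lintegral _ _))
    have := ENNReal.toReal_mono hfin this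
    simpa using this
  · calc y * ξ ≤ |y * ξ| := le_abs_self _
      _ = |y| * |ξ| := abs_mul _ _
      _ ≤ _ := by gcongr

lemma FF_indep (s : ℝ) {f : ℂ → ℂ} (hf : f ∈ Zsub s) (ξ y1 y2 : ℝ) : FF f ξ y1 = FF f ξ y2 := by
  set g : ℂ → ℂ := fun z => f z * Complex.exp (-I * z * ξ) with hg
  have hgd : Differentiable ℂ g := by
    have := hf.1
    fun_prop
  have hrect : ∀ T : ℝ, (∫ x in (-T)..T, g (x + y1 * I)) - (∫ x in (-T)..T, g (x + y2 * I)) +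
      I * (∫ y in y1..y2, g (T + y * I)) - I * (∫ y in y1..y2, g ((-T : ℝ) + y * I)) = 0 := by
    intro T
    have := Complex.integral_boundary_rect_eq_zero_of_differentiableOn g
      ((-T : ℝ) + y1 * I) (T + y2 * I) hgd.differentiableOn
    have a1 : (((-T : ℝ) : ℂ) + y1 * I).re = -T := by simp
    have a2 : (((-T : ℝ) : ℂ) + y1 * I).im = y1 := by simp
    have a3 : ((T : ℂ) + y2 * I).re = T := by simp
    have a4 : ((T : ℂ) + y2 * I).im = y2 := by simp
    rw [a1, a2, a3, a4] at this
    simpa only [smul_eq_mul] using this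
  have t1 : ∀ y : ℝ, Filter.Tendsto (fun T : ℝ => ∫ x in (-T)..T, g (x + y * I)) Filter.atTop
      (nhds (FF f ξ y)) := fun y =>
    intervalIntegral_tendsto_integral (FF_integrable s hf ξ y) Filter.tendsto_neg_atTop_atBot
      Filter.tendsto_id
  have t2 : Filter.Tendsto (fun T : ℝ => ∫ y in y1..y2, g (T + y * I)) Filter.atTop (nhds 0) :=
    side_tendsto s hf ξ y1 y2 Filter.tendsto_abs_atTop_atTop
  have t3 : Filter.Tendsto (fun T : ℝ => ∫ y in y1..y2, g ((-T : ℝ) + y * I)) Filter.atTop (nhds 0) :=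
    (side_tendsto s hf ξ y1 y2 (l := Filter.atBot) Filter.tendsto_abs_atBot_atTop).comp
      Filter.tendsto_neg_atTop_atBot
  have t4 := (((t1 y1).sub (t1 y2)).add (t2.const_mul I)).sub (t3.const_mul I)
  simp only [hrect, mul_zero, add_zero, sub_zero] at t4
  exact sub_eq_zero.1 (tendsto_nhds_unique tendsto_const_nhds t4).symm

lemma exp_growth {s a : ℝ} (hs : -1 < s) (ha : 0 < a) {t : ℝ} (ht : 1 ≤ t) :
    a ≤ Real.exp (a * t) * t ^ s := by
  have h1 : t ^ (-1 : ℝ) ≤ t ^ s := Real.rpow_le_rpow_of_exponent_le ht hs.le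
  have h2 : a * t ≤ Real.exp (a * t) := by linarith [Real.add_one_le_exp (a * t)]
  have ht0 : 0 < t := by linarith
  calc a = (a * t) * t ^ (-1 : ℝ) := by rw [Real.rpow_neg_one]; field_simp
    _ ≤ _ := by gcongr

lemma FF_zero_aux {s : ℝ} (hs : -1 < s) {f : ℂ → ℂ} (hf : f ∈ Zsub s) {ξ a : ℝ} (ha : 0 < a)
    (S : Set ℝ) (mS : MeasurableSet S) (hS : volume S = ⊤)
    (hSy : ∀ y ∈ S, 1 ≤ |y| ∧ -π * |y| - y * ξ = a * |y|) : FF f ξ 0 = 0 := by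
  by_contra hne
  have h1 : ∀ y ∈ S, ENNReal.ofReal a * ‖FF f ξ 0‖ₑ ≤
      ∫⁻ x : ℝ, ENNReal.ofReal (wt s (x + y * I)) * ‖f (x + y * I)‖ₑ := by
    intro y hy
    obtain ⟨hy1, hy2⟩ := hSy y hy
    rw [FF_indep s hf ξ 0 y]
    calc ENNReal.ofReal a * ‖FF f ξ y‖ₑ ≤ ENNReal.ofReal a *
          ∫⁻ x : ℝ, ENNReal.ofReal (Real.exp (y * ξ)) * ‖f (x + y * I)‖ₑ := by
          gcongr
          refine (enorm_integral_le_lintegral_enorm _).trans (le_of_eq ?_)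
          congr 1; ext x
          rw [enorm_mul, ← ofReal_norm (Complex.exp _), norm_expo, mul_comm]
      _ = ∫⁻ x : ℝ, ENNReal.ofReal (a * Real.exp (y * ξ)) * ‖f (x + y * I)‖ₑ := by
          rw [lintegral_const_mul' _ _ ENNReal.ofReal_ne_top,
            lintegral_const_mul' _ _ ENNReal.ofReal_ne_top, ENNReal.ofReal_mul ha.le, mul_assoc]
      _ ≤ _ := by
          gcongr with x
          have := exp_growth hs ha hy1
          rw [wt]
          have zi : ((x:ℂ) + y * I).im = y := by simp
          rw [zi]
          calc a * Real.exp (y * ξ) ≤ (Real.exp (a * |y|) * |y| ^ s) * Real.exp (y * ξ) := by gcongr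
            _ = Real.exp (a * |y| + y * ξ) * |y| ^ s := by rw [Real.exp_add]; ring
            _ = _ := by rw [← hy2]; ring_nf
  have h2 : ∫⁻ y in S, ENNReal.ofReal a * ‖FF f ξ 0‖ₑ ≤ ZN s f := by
    unfold ZN
    rw [lint_complex (ZN_integrand_measurable s hf.1)]
    refine (setLIntegral_mono' mS h1).trans (setLIntegral_le_lintegral _ _)
  rw [setLIntegral_const, hS, ENNReal.mul_top] at h2
  · exact absurd (lt_of_le_of_lt h2 hf.2) (lt_irrefl _)
  · simp [ha, hne]

lemma FF_zero {s : ℝ} (hs : -1 < s) {f : ℂ → ℂ} (hf : f ∈ Zsub s) {ξ : ℝ} (hξ : π < |ξ|) :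
    FF f ξ 0 = 0 := by
  rcases le_total 0 ξ with h | h
  · rw [abs_of_nonneg h] at hξ
    refine FF_zero_aux hs hf (a := ξ - π) (by linarith) (Set.Iic (-1)) measurableSet_Iic
      Real.volume_Iic ?_
    intro y hy
    have hy : y ≤ -1 := hy
    rw [abs_of_nonpos (by linarith)]
    exact ⟨by linarith, by ring⟩
  · rw [abs_of_nonpos h] at hξ
    refine FF_zero_aux hs hf (a := -ξ - π) (by linarith) (Set.Ici 1) measurableSet_Ici
      Real.volume_Ici ?_
    intro y hy
    have hy : 1 ≤ y := hy
    rw [abs_of_nonneg (by linarith)]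
    exact ⟨by linarith, by ring⟩

lemma fourier_line (s : ℝ) {f : ℂ → ℂ} (hf : f ∈ Zsub s) (y v : ℝ) :
    FourierTransform.fourier (fun x : ℝ => f (x + y * I)) v =
      Real.exp (-(2 * π * y * v)) * FF f (2 * π * v) 0 := by
  rw [FF_indep s hf _ 0 y, Real.fourier_real_eq_integral_exp_smul, FF, ← integral_const_mul]
  congr 1; ext x
  rw [smul_eq_mul, Complex.ofReal_exp, mul_comm, mul_left_comm, ← Complex.exp_add]
  congr 2
  push_cast
  linear_combination (2 * π * y * v) * Complex.I_sq

lemma fourier_line_continuous (s : ℝ) {f : ℂ → ℂ} (hf : f ∈ Zsub s) :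
    Continuous fun v : ℝ => FF f (2 * π * v) 0 := by
  have h : Continuous (FourierTransform.fourier (fun x : ℝ => f (x + (0:ℝ) * I))) :=
    VectorFourier.fourierIntegral_continuous Real.continuous_fourierChar
      (by exact continuous_inner) (line_integrable s hf 0)
  refine h.congr (fun v => ?_)
  rw [fourier_line s hf 0 v]; simp

/-- Paley-Wiener representation. -/
theorem paley_wiener {s : ℝ} (hs : -1 < s) {f : ℂ → ℂ} (hf : f ∈ Zsub s) :
    ∃ H : ℝ → ℂ, Continuous H ∧ ∀ z : ℂ, f z = Complex.exp (-I * π * z) *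
      ∫ τ in (0:ℝ)..1, H τ * Complex.exp (2 * π * I * z * τ) := by
  set H0 : ℝ → ℂ := fun v => FF f (2 * π * v) 0 with hH0
  have cH0 : Continuous H0 := fourier_line_continuous s hf
  have zH0 : ∀ v : ℝ, v ∉ Set.Ioc (-(1/2) : ℝ) (1/2) → v ≠ -(1/2) → H0 v = 0 := by
    intro v hv hv2
    apply FF_zero hs hf
    have : 1/2 < |v| := by
      by_contra h
      push Not at h
      exact hv ⟨lt_of_le_of_ne (abs_le.1 h).1 (Ne.symm hv2), (abs_le.1 h).2⟩
    rw [abs_mul, abs_of_pos (by positivity)]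
    nlinarith [pi_pos]
  refine ⟨fun τ => H0 (τ - 1/2), by fun_prop, fun z => ?_⟩
  set y := z.im with hy
  set φ : ℝ → ℂ := fun x : ℝ => f (x + y * I) with hφ
  have hφF : ∀ v, FourierTransform.fourier φ v = Real.exp (-(2 * π * y * v)) * H0 v := fourier_line s hf y
  have hφF' : FourierTransform.fourier φ = fun v => Real.exp (-(2 * π * y * v)) * H0 v := funext hφF
  have cF : Continuous fun v : ℝ => (Real.exp (-(2 * π * y * v)) : ℂ) * H0 v := by fun_prop
  have hFint : Integrable (FourierTransform.fourier φ) := by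
    rw [hφF']
    apply cF.integrable_of_hasCompactSupport
    refine HasCompactSupport.intro (K := Set.Icc (-(1/2)) (1/2)) isCompact_Icc (fun v hv => ?_)
    rw [zH0 v (fun h => hv ⟨h.1.le, h.2⟩) (fun h => hv ⟨h.ge, by rw [h]; norm_num⟩), mul_zero]
  have hcont : Continuous φ := by
    have := hf.1.continuous
    fun_prop
  have inv := congrFun (hcont.fourierInv_fourier_eq (line_integrable s hf y) hFint) z.re
  have hφz : φ z.re = f z := by simp [hφ, hy]
  rw [hφz, Real.fourierInv_eq', hφF'] at inv
  rw [← inv]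
  have e1 : ∀ v : ℝ, Complex.exp (↑(2 * π * inner ℝ v z.re) * I) •
      ((Real.exp (-(2 * π * y * v)) : ℂ) * H0 v) = Complex.exp (2 * π * I * z * v) * H0 v := by
    intro v
    rw [smul_eq_mul, ← mul_assoc, Complex.ofReal_exp, ← Complex.exp_add]
    congr 2
    have hz : (z : ℂ) = z.re + y * I := by simp [hy]
    conv_rhs => rw [hz]
    simp only [RCLike.inner_apply, conj_trivial]
    push_cast
    linear_combination (-2 * π * y * v) * Complex.I_sq
  simp_rw [e1]
  have e2 : ∫ v : ℝ, Complex.exp (2 * π * I * z * v) * H0 v =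
      ∫ v in (-(1/2):ℝ)..(1/2), Complex.exp (2 * π * I * z * v) * H0 v := by
    rw [intervalIntegral.integral_of_le (by norm_num)]
    symm
    apply setIntegral_eq_integral_of_ae_compl_eq_zero
    filter_upwards [(Set.finite_singleton (-(1/2) : ℝ)).measure_zero volume |> compl_mem_ae_iff.2] with v hv1 hv2
    rw [zH0 v hv2 hv1, mul_zero]
  rw [e2]
  have e3 := intervalIntegral.integral_comp_sub_right (a := 0) (b := 1)
    (fun v : ℝ => Complex.exp (2 * π * I * z * v) * H0 v) (1/2 : ℝ)
  norm_num at e3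
  norm_num
  rw [← e3, ← intervalIntegral.integral_const_mul]
  congr 1; ext τ
  rw [mul_comm (H0 _), ← mul_assoc, ← Complex.exp_add]
  congr 2
  ring

end Part5

section Part6
open MeasureTheory Real Complex
open scoped ENNReal NNReal ContDiff

noncomputable def th (τ : ℝ) : ℝ := 1 - Real.exp (-4 * π * τ)

lemma th_zero : th 0 = 0 := by simp [th]
lemma th_nonneg {τ : ℝ} (h : 0 ≤ τ) : 0 ≤ th τ := by
  rw [th, sub_nonneg]; apply Real.exp_le_one_iff.2; nlinarith [pi_pos]
lemma th_le {τ : ℝ} : th τ ≤ 4 * π * τ := by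
  rw [th]; have := Real.add_one_le_exp (-4 * π * τ); linarith
lemma th_contDiff : ContDiff ℝ ∞ th := by unfold th; fun_prop

noncomputable def nxt (m : ℕ) (b : ℝ → ℝ) (τ : ℝ) : ℝ :=
  4 * π * (m + 1) * Real.exp (-4 * π * τ) * b τ + th τ * deriv b τ

lemma nxt_contDiff (m : ℕ) {b : ℝ → ℝ} (hb : ContDiff ℝ ∞ b) : ContDiff ℝ ∞ (nxt m b) := by
  have h1 := th_contDiff
  have h2 : ContDiff ℝ ∞ (deriv b) := by
    have : ContDiff ℝ ((∞ : WithTop ℕ∞) + 1) b := by simpa using hb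
    exact ((contDiff_succ_iff_deriv).1 this).2.2
  unfold nxt
  fun_prop

lemma nxt_zero (m : ℕ) {b : ℝ → ℝ} (hb : ∀ τ > 3/4, b τ = 0) : ∀ τ > 3/4, nxt m b τ = 0 := by
  intro τ hτ
  have : deriv b τ = 0 := by
    have h : b =ᶠ[nhds τ] fun _ => 0 := by
      filter_upwards [lt_mem_nhds hτ] with t ht using hb t ht
    rw [h.deriv_eq]; simp
  rw [nxt, hb τ hτ, this]; simp

lemma nxt_hasDerivAt (m : ℕ) {b : ℝ → ℝ} (hb : ContDiff ℝ ∞ b) (τ : ℝ) :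
    HasDerivAt (fun τ => th τ ^ (m + 1) * b τ) (th τ ^ m * nxt m b τ) τ := by
  have h1 : HasDerivAt th (4 * π * Real.exp (-4 * π * τ)) τ := by
    have := (((hasDerivAt_id τ).const_mul (-4 * π)).exp).const_sub 1
    exact this.congr_deriv (by simp; ring)
  have h2 : HasDerivAt b (deriv b τ) τ := (hb.differentiable (by simp)).differentiableAt.hasDerivAt
  refine ((h1.pow (m + 1)).mul h2).congr_deriv ?_
  simp [nxt]
  ring

/-- Laplace type integral. -/
noncomputable def LI (v : ℝ → ℝ) (ζ : ℂ) : ℂ := ∫ τ in (0:ℝ)..1, Complex.exp (ζ * τ) * v τ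

lemma LI_ibp {v v1 : ℝ → ℝ} (hv : ∀ τ, HasDerivAt v (v1 τ) τ) (hc : Continuous v1) (h0 : v 0 = 0)
    (h1 : v 1 = 0) (ζ : ℂ) : ζ * LI v ζ = - LI v1 ζ := by
  have d1 : ∀ τ : ℝ, HasDerivAt (fun τ : ℝ => Complex.exp (ζ * τ)) (ζ * Complex.exp (ζ * τ)) τ := by
    intro τ
    have := (((hasDerivAt_id (τ:ℂ)).const_mul ζ).cexp).comp_ofReal
    exact this.congr_deriv (by simp; ring)
  have := intervalIntegral.integral_deriv_mul_eq_sub (a := 0) (b := 1)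
    (u := fun τ : ℝ => Complex.exp (ζ * τ)) (v := fun τ => (v τ : ℂ))
    (u' := fun τ : ℝ => ζ * Complex.exp (ζ * τ)) (v' := fun τ => (v1 τ : ℂ))
    (fun τ _ => d1 τ) (fun τ _ => (hv τ).ofReal_comp)
    (Continuous.intervalIntegrable (by fun_prop) _ _)
    (Continuous.intervalIntegrable (by fun_prop) _ _)
  have cv : Continuous v := continuous_iff_continuousAt.2 fun τ => (hv τ).continuousAt
  simp only [h0, h1] at this
  rw [intervalIntegral.integral_add (Continuous.intervalIntegrable (by fun_prop) _ _)
    (Continuous.intervalIntegrable (by fun_prop) _ _)] at this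
  simp only [ofReal_zero, mul_zero, sub_zero, mul_assoc, intervalIntegral.integral_const_mul] at this
  unfold LI
  exact eq_neg_of_add_eq_zero_left this

lemma exp_poly_bound (m : ℕ) {R τ : ℝ} (hR : 0 < R) (hτ : 0 ≤ τ) :
    Real.exp (-R * τ) * τ ^ m ≤ m.factorial * (2 / R) ^ m * Real.exp (-(R / 2) * τ) := by
  have h := Real.pow_div_factorial_le_exp (R / 2 * τ) (by positivity) m
  rw [div_le_iff₀ (by positivity)] at h
  have e : τ ^ m = (2 / R) ^ m * (R / 2 * τ) ^ m := by
    rw [← mul_pow]; congr 1; field_simp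
  calc Real.exp (-R * τ) * τ ^ m = Real.exp (-R * τ) * ((2 / R) ^ m * (R / 2 * τ) ^ m) := by rw [← e]
    _ ≤ Real.exp (-R * τ) * ((2 / R) ^ m * (Real.exp (R / 2 * τ) * m.factorial)) := by gcongr
    _ = m.factorial * (2 / R) ^ m * (Real.exp (-R * τ) * Real.exp (R / 2 * τ)) := by ring
    _ = _ := by rw [← Real.exp_add]; congr 2; ring

lemma LI_bound {v : ℝ → ℝ} {D : ℝ} (m : ℕ)
    (hv : ∀ τ ∈ Set.Icc (0:ℝ) (3/4), |v τ| ≤ D * τ ^ m) (hz : ∀ τ > 3/4, v τ = 0) (hD : 0 ≤ D)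
    {ζ : ℂ} {w M R : ℝ} (hw : 0 ≤ w) (hM : 0 ≤ M) (hR : 0 < R)
    (h : ∀ τ ∈ Set.Icc (0:ℝ) (3/4), w * Real.exp (ζ.re * τ) ≤ M * Real.exp (-R * τ)) :
    w * ‖LI v ζ‖ * R ^ (m + 1) ≤ D * M * (m.factorial * 2 ^ (m + 1)) := by
  set K : ℝ := D * M * (m.factorial * (2 / R) ^ m) with hK
  have hK0 : 0 ≤ K := by positivity
  have pt : ∀ τ ∈ Set.Ioc (0:ℝ) 1, ‖(w : ℂ) * (Complex.exp (ζ * τ) * v τ)‖ ≤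
      K * Real.exp (-(R / 2) * τ) := by
    intro τ hτ
    rcases le_or_gt τ (3/4) with h34 | h34
    · have hm : τ ∈ Set.Icc (0:ℝ) (3/4) := ⟨hτ.1.le, h34⟩
      rw [norm_mul, norm_mul, Complex.norm_exp, norm_real, norm_real, Real.norm_eq_abs,
        Real.norm_eq_abs, abs_of_nonneg hw, Complex.re_mul_ofReal]
      calc w * (Real.exp (ζ.re * τ) * |v τ|) = (w * Real.exp (ζ.re * τ)) * |v τ| := by ring
        _ ≤ (M * Real.exp (-R * τ)) * (D * τ ^ m) := by
          apply mul_le_mul (h τ hm) (hv τ hm) (by positivity) (by positivity)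
        _ = D * M * (Real.exp (-R * τ) * τ ^ m) := by ring
        _ ≤ D * M * (m.factorial * (2 / R) ^ m * Real.exp (-(R / 2) * τ)) := by
          exact mul_le_mul_of_nonneg_left (exp_poly_bound m hR hτ.1.le) (by positivity)
        _ = _ := by rw [hK]; ring
    · rw [hz τ h34]; simp; positivity
  have h2 : w * ‖LI v ζ‖ ≤ ∫ τ in (0:ℝ)..1, K * Real.exp (-(R / 2) * τ) := by
    have : w * ‖LI v ζ‖ = ‖∫ τ in (0:ℝ)..1, (w : ℂ) * (Complex.exp (ζ * τ) * v τ)‖ := by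
      rw [intervalIntegral.integral_const_mul, norm_mul, norm_real, Real.norm_eq_abs,
        abs_of_nonneg hw, LI]
    rw [this]
    exact intervalIntegral.norm_integral_le_of_norm_le zero_le_one
      (Filter.Eventually.of_forall fun τ hτ => pt τ hτ)
      (Continuous.intervalIntegrable (by fun_prop) _ _)
  have h3 : ∫ τ in (0:ℝ)..1, K * Real.exp (-(R / 2) * τ) ≤ K * (2 / R) := by
    rw [intervalIntegral.integral_const_mul]
    gcongr
    rw [intervalIntegral.integral_comp_mul_left (fun x => Real.exp x) (by
      have : 0 < R / 2 := by positivity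
      exact neg_ne_zero.2 this.ne'), integral_exp]
    simp only [mul_zero, mul_one, Real.exp_zero, smul_eq_mul]
    rw [show (-(R / 2))⁻¹ * (Real.exp (-(R/2)) - 1) = (2 / R) * (1 - Real.exp (-(R/2))) by
      field_simp; ring]
    apply mul_le_of_le_one_right (by positivity)
    linarith [Real.exp_pos (-(R/2))]
  calc w * ‖LI v ζ‖ * R ^ (m + 1) ≤ K * (2 / R) * R ^ (m + 1) := by
        exact mul_le_mul_of_nonneg_right (h2.trans h3) (by positivity)
    _ = D * M * (m.factorial * ((2 / R) * R) ^ (m + 1)) := by rw [hK, mul_pow, pow_succ (2 / R)]; ring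
    _ = _ := by rw [div_mul_cancel₀ _ hR.ne']

lemma LI_differentiable {v : ℝ → ℝ} (hc : Continuous v) : Differentiable ℂ (LI v) := by
  intro ζ0
  have key := intervalIntegral.hasDerivAt_integral_of_dominated_loc_of_deriv_le
    (μ := volume) (a := (0:ℝ)) (b := 1) (F := fun (ζ : ℂ) (τ : ℝ) => Complex.exp (ζ * τ) * v τ)
    (F' := fun (ζ : ℂ) (τ : ℝ) => τ * Complex.exp (ζ * τ) * v τ) (x₀ := ζ0)
    (s := Metric.ball ζ0 1) (bound := fun τ => Real.exp (‖ζ0‖ + 1) * |v τ|)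
    (Metric.ball_mem_nhds _ one_pos)
    (Filter.Eventually.of_forall fun ζ => Continuous.aestronglyMeasurable (by fun_prop))
    (Continuous.intervalIntegrable (by fun_prop) _ _)
    (Continuous.aestronglyMeasurable (by fun_prop))
    (Filter.Eventually.of_forall fun τ hτ ζ hζ => by
      rw [Set.uIoc_of_le zero_le_one] at hτ
      rw [norm_mul, norm_mul, norm_real, norm_real, Real.norm_eq_abs, Real.norm_eq_abs,
        abs_of_pos hτ.1]
      gcongr
      have h1 : ‖ζ‖ ≤ ‖ζ0‖ + 1 := by
        rw [mem_ball_iff_norm] at hζ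
        have := norm_sub_norm_le ζ ζ0
        linarith
      have h2 : ‖Complex.exp (ζ * τ)‖ ≤ Real.exp (‖ζ0‖ + 1) := by
        rw [Complex.norm_exp]
        apply Real.exp_le_exp.2
        calc (ζ * τ).re ≤ ‖ζ * τ‖ := Complex.re_le_norm _
          _ = ‖ζ‖ * τ := by rw [norm_mul, norm_real, Real.norm_eq_abs, abs_of_pos hτ.1]
          _ ≤ ‖ζ‖ * 1 := by gcongr; exact hτ.2
          _ ≤ _ := by linarith
      calc τ * ‖Complex.exp (ζ * τ)‖ ≤ 1 * Real.exp (‖ζ0‖ + 1) := by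
            gcongr; exact hτ.2
        _ = _ := one_mul _)
    (Continuous.intervalIntegrable (by fun_prop) _ _)
    (Filter.Eventually.of_forall fun τ hτ ζ hζ => by
      have := (((hasDerivAt_id ζ).mul_const (τ:ℂ)).cexp).mul_const (v τ : ℂ)
      exact this.congr_deriv (by simp only [id]; ring))
  exact key.2.differentiableAt

lemma bdd_cont {b : ℝ → ℝ} (hb : Continuous b) :
    ∃ D, 0 ≤ D ∧ ∀ τ ∈ Set.Icc (0:ℝ) (3/4), |b τ| ≤ D := by
  obtain ⟨D, hD⟩ := (isCompact_Icc (a := (0:ℝ)) (b := 3/4)).exists_bound_of_continuousOn hb.continuousOn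
  exact ⟨max D 0, le_max_right _ _, fun τ hτ => (hD τ hτ).trans (le_max_left _ _)⟩

lemma thb_bound (m : ℕ) {b : ℝ → ℝ} (hb : Continuous b) :
    ∃ D, 0 ≤ D ∧ ∀ τ ∈ Set.Icc (0:ℝ) (3/4), |th τ ^ m * b τ| ≤ D * τ ^ m := by
  obtain ⟨D, hD, h⟩ := bdd_cont hb
  refine ⟨(4 * π) ^ m * D, by positivity, fun τ hτ => ?_⟩
  rw [abs_mul, abs_pow, abs_of_nonneg (th_nonneg hτ.1)]
  calc th τ ^ m * |b τ| ≤ (4 * π * τ) ^ m * D := by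
        have := th_nonneg hτ.1
        have := hτ.1
        exact mul_le_mul (pow_le_pow_left₀ (th_nonneg hτ.1) th_le m) (h τ hτ) (abs_nonneg _)
          (by positivity)
    _ = _ := by rw [mul_pow]; ring

/-- main bound for the Laplace integral of `th ^ (k+2) * b` -/
lemma Q_bound (k : ℕ) {b : ℝ → ℝ} (hb : ContDiff ℝ ∞ b) (hz : ∀ τ > 3/4, b τ = 0) :
    ∃ C : ℝ, 0 ≤ C ∧ ∀ (ζ : ℂ) (w M R : ℝ), 0 ≤ w → 0 ≤ M → 0 < R →
      (∀ τ ∈ Set.Icc (0:ℝ) (3/4), w * Real.exp (ζ.re * τ) ≤ M * Real.exp (-R * τ)) →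
      w * ‖LI (fun τ => th τ ^ (k + 2) * b τ) ζ‖ * (R ^ 2 + ζ.im ^ 2) * R ^ (k + 1) ≤ C * M := by
  set b1 := nxt (k + 1) b with hb1
  set b2 := nxt k b1 with hb2
  have cb1 : ContDiff ℝ ∞ b1 := nxt_contDiff _ hb
  have cb2 : ContDiff ℝ ∞ b2 := nxt_contDiff _ cb1
  have cth := th_contDiff.continuous
  have cb1' := cb1.continuous
  have cb2' := cb2.continuous
  have cb' := hb.continuous
  have z1 : ∀ τ > 3/4, b1 τ = 0 := nxt_zero (k + 1) hz
  have z2 : ∀ τ > 3/4, b2 τ = 0 := nxt_zero k z1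
  obtain ⟨D, hD0, hD⟩ := thb_bound (k + 2) cb'
  obtain ⟨D2, hD20, hD2⟩ := thb_bound k cb2'
  refine ⟨D * ((k+2).factorial * 2 ^ (k + 3)) + D2 * (k.factorial * 2 ^ (k + 1)), by positivity, ?_⟩
  intro ζ w M R hw hM hR h
  set Q := LI (fun τ => th τ ^ (k + 2) * b τ) ζ with hQ
  have ibp : ζ ^ 2 * Q = LI (fun τ => th τ ^ k * b2 τ) ζ := by
    have i1 := LI_ibp (nxt_hasDerivAt (k + 1) hb) ((cth.pow _).mul cb1') (by simp [th_zero])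
      (by rw [hz 1 (by norm_num)]; simp) ζ
    have i2 := LI_ibp (nxt_hasDerivAt k cb1) ((cth.pow _).mul cb2') (by simp [th_zero])
      (by rw [z1 1 (by norm_num)]; simp) ζ
    rw [sq, mul_assoc, hQ]
    rw [show k + 2 = k + 1 + 1 from rfl, i1, mul_neg, i2, neg_neg]
  have B1 := LI_bound (v := fun τ => th τ ^ (k + 2) * b τ) (k + 2) hD
    (fun τ hτ => by rw [hz τ hτ, mul_zero]) hD0 hw hM hR h
  have B2 := LI_bound (v := fun τ => th τ ^ k * b2 τ) k hD2
    (fun τ hτ => by rw [z2 τ hτ, mul_zero]) hD20 hw hM hR h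
  rw [← ibp, norm_mul, norm_pow] at B2
  have hi : ζ.im ^ 2 ≤ ‖ζ‖ ^ 2 := by
    rw [← sq_abs]; gcongr; exact Complex.abs_im_le_norm ζ
  calc w * ‖Q‖ * (R ^ 2 + ζ.im ^ 2) * R ^ (k + 1) ≤ w * ‖Q‖ * (R ^ 2 + ‖ζ‖ ^ 2) * R ^ (k + 1) := by
        gcongr
    _ = w * ‖Q‖ * R ^ (k + 2 + 1) + w * (‖ζ‖ ^ 2 * ‖Q‖) * R ^ (k + 1) := by ring
    _ ≤ _ := by rw [add_mul]; refine (add_le_add B1 B2).trans (le_of_eq ?_); ring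

end Part6

section Part7
open MeasureTheory Real Complex
open scoped ENNReal NNReal ContDiff

/-- smooth cutoff with `chi τ + chi (1 - τ) = 1`. -/
noncomputable def chi (τ : ℝ) : ℝ := Real.smoothTransition (3/2 - 2 * τ)

lemma chi_contDiff : ContDiff ℝ ∞ chi := by
  unfold chi
  exact Real.smoothTransition.contDiff.comp (by fun_prop)

lemma chi_zero {τ : ℝ} (h : 3/4 < τ) : chi τ = 0 :=
  Real.smoothTransition.zero_of_nonpos (by linarith)

lemma chi_add (τ : ℝ) : chi τ + chi (1 - τ) = 1 := by
  have h := (Real.smoothTransition.pos_denom (3/2 - 2 * τ)).ne'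
  unfold chi Real.smoothTransition
  have e1 : 3/2 - 2 * (1 - τ) = 1 - (3/2 - 2 * τ) := by ring
  have e2 : 1 - (1 - (3/2 - 2 * τ)) = 3/2 - 2 * τ := by ring
  rw [e1, e2, add_comm (expNegInvGlue (1 - (3/2 - 2 * τ))), ← add_div, div_self h]

noncomputable def bb (τ : ℝ) : ℝ := chi τ * Real.exp (2 * π * τ)

lemma bb_contDiff : ContDiff ℝ ∞ bb := by
  have := chi_contDiff
  unfold bb; fun_prop

lemma bb_zero : ∀ τ > 3/4, bb τ = 0 := fun τ h => by rw [bb, chi_zero h, zero_mul]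

/-- The kernel density. -/
noncomputable def uu (k : ℕ) (τ : ℝ) : ℝ := th τ ^ (k + 2) * bb τ

lemma uu_continuous (k : ℕ) : Continuous (uu k) := by
  have := th_contDiff.continuous
  have := bb_contDiff.continuous
  unfold uu; fun_prop

/-- kernel -/
noncomputable def qq (k j : ℕ) (z : ℂ) : ℂ := LI (uu k) (2 * π * I * z - 2 * π * j)

lemma qq_differentiable (k j : ℕ) : Differentiable ℂ (qq k j) :=
  (LI_differentiable (uu_continuous k)).comp (by fun_prop)

noncomputable def gg (k j : ℕ) (z : ℂ) : ℂ := cexp (-I * π * z) * qq k j z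

lemma gg_differentiable (k j : ℕ) : Differentiable ℂ (gg k j) := by
  have := qq_differentiable k j
  unfold gg; fun_prop

lemma gg_bound (k : ℕ) : ∃ C : ℝ, 0 ≤ C ∧ ∀ (j : ℕ) (x y : ℝ),
    Real.exp (-π * |y|) * ‖gg k j (x + y * I)‖ *
      (((1 + j + |y|) ^ 2 + x ^ 2) * (1 + j + |y|) ^ (k + 1)) ≤ C := by
  obtain ⟨C, hC, h⟩ := Q_bound k bb_contDiff bb_zero
  refine ⟨C * (Real.exp 2 * (k + 3).factorial), by positivity, fun j x y => ?_⟩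
  have hj : (0:ℝ) ≤ j := Nat.cast_nonneg j
  have hpi := pi_gt_three
  set ζ : ℂ := 2 * π * I * (x + y * I) - 2 * π * j with hζ
  have hre : ζ.re = -2 * π * (y + j) := by simp [hζ]; ring
  have him : ζ.im = 2 * π * x := by simp [hζ]
  have hn : ‖gg k j (x + y * I)‖ = Real.exp (π * y) * ‖LI (uu k) ζ‖ := by
    rw [gg, norm_mul, Complex.norm_exp]
    congr 2
    simp
  have hx : x ^ 2 ≤ ζ.im ^ 2 := by
    rw [him, mul_pow]
    have : 1 ≤ (2 * π) ^ 2 := by nlinarith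
    nlinarith [sq_nonneg x]
  rw [hn]
  have fac : (1:ℝ) ≤ (k + 3).factorial := by exact_mod_cast Nat.succ_le_of_lt (Nat.factorial_pos _)
  rcases le_total 0 y with hy | hy
  · have := h ζ 1 (Real.exp 1) (1 + j + y) zero_le_one (Real.exp_nonneg _) (by positivity) (by
      intro τ hτ
      rw [hre, one_mul, ← Real.exp_add]
      apply Real.exp_le_exp.2
      have h1 := hτ.1
      have h2 := hτ.2
      have : 0 ≤ (y + j) * τ := by positivity
      nlinarith)
    rw [abs_of_nonneg hy]
    have e : Real.exp (-π * y) * Real.exp (π * y) = 1 := by rw [← Real.exp_add]; simp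
    calc _ = (Real.exp (-π * y) * Real.exp (π * y)) * ‖LI (uu k) ζ‖ * ((1 + j + y) ^ 2 + x ^ 2) * (1 + j + y) ^ (k + 1) := by ring
      _ ≤ 1 * ‖LI (uu k) ζ‖ * ((1 + j + y) ^ 2 + ζ.im ^ 2) * (1 + j + y) ^ (k + 1) := by
          rw [e]
          apply mul_le_mul_of_nonneg_right _ (by positivity)
          apply mul_le_mul_of_nonneg_left _ (by positivity)
          linarith
      _ ≤ C * Real.exp 1 := this
      _ ≤ _ := by
          apply mul_le_mul_of_nonneg_left _ hC
          calc Real.exp 1 = Real.exp 1 * 1 := by ring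
            _ ≤ Real.exp 2 * (k + 3).factorial := mul_le_mul (Real.exp_le_exp.2 (by norm_num)) fac zero_le_one (Real.exp_nonneg _)
  · obtain ⟨η, rfl⟩ : ∃ η, y = -η := ⟨-y, by simp⟩
    have hη : 0 ≤ η := by linarith
    rw [abs_neg, abs_of_nonneg hη]
    have := h ζ (Real.exp (-2 * π * η)) (Real.exp (1 - η)) (1 + j) (Real.exp_nonneg _) (Real.exp_nonneg _) (by positivity) (by
      intro τ hτ
      rw [hre, ← Real.exp_add, ← Real.exp_add]
      apply Real.exp_le_exp.2
      have h1 := hτ.1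
      have h2 := hτ.2
      have a1 : 0 ≤ j * τ := by positivity
      have a2 : 0 ≤ η * (3/4 - τ) := mul_nonneg hη (by linarith)
      nlinarith)
    have e : Real.exp (-π * η) * Real.exp (π * -η) = Real.exp (-2 * π * η) := by
      rw [← Real.exp_add]; congr 1; ring
    have p1 : 1 + j + η ≤ (1 + η) * (1 + j) := by nlinarith
    have p2 : ((1 + j + η) ^ 2 + x ^ 2) ≤ (1 + η) ^ 2 * ((1 + j) ^ 2 + ζ.im ^ 2) := by
      rw [mul_add, ← mul_pow]
      have : ζ.im ^ 2 ≤ (1 + η) ^ 2 * ζ.im ^ 2 := by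
        apply le_mul_of_one_le_left (sq_nonneg _); nlinarith
      have := pow_le_pow_left₀ (by positivity) p1 2
      linarith
    have p3 : (1 + j + η) ^ (k + 1) ≤ (1 + η) ^ (k + 1) * (1 + j) ^ (k + 1) := by
      rw [← mul_pow]; exact pow_le_pow_left₀ (by positivity) p1 _
    have p4 : (1 + η) ^ (k + 3) ≤ (k + 3).factorial * Real.exp (1 + η) := by
      have := Real.pow_div_factorial_le_exp (1 + η) (by positivity) (k + 3)
      rw [div_le_iff₀ (by positivity)] at this
      linarith
    calc _ = Real.exp (-2 * π * η) * ‖LI (uu k) ζ‖ * (((1 + j + η) ^ 2 + x ^ 2) * (1 + j + η) ^ (k + 1)) := by rw [← e]; ring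
      _ ≤ Real.exp (-2 * π * η) * ‖LI (uu k) ζ‖ * (((1 + η) ^ 2 * ((1 + j) ^ 2 + ζ.im ^ 2)) * ((1 + η) ^ (k + 1) * (1 + j) ^ (k + 1))) := by
          apply mul_le_mul_of_nonneg_left _ (by positivity)
          exact mul_le_mul p2 p3 (by positivity) (by positivity)
      _ = (1 + η) ^ (k + 3) * (Real.exp (-2 * π * η) * ‖LI (uu k) ζ‖ * ((1 + j) ^ 2 + ζ.im ^ 2) * (1 + j) ^ (k + 1)) := by ring
      _ ≤ ((k + 3).factorial * Real.exp (1 + η)) * (C * Real.exp (1 - η)) :=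
          mul_le_mul p4 this (by positivity) (by positivity)
      _ = C * ((Real.exp (1 + η) * Real.exp (1 - η)) * (k + 3).factorial) := by ring
      _ = _ := by rw [← Real.exp_add]; norm_num

lemma lint_scale {R : ℝ} (hR : 0 < R) {F : ℝ → ℝ≥0∞} (hF : Measurable F) :
    ∫⁻ x, F x = ENNReal.ofReal R * ∫⁻ t, F (R * t) := by
  conv_lhs => rw [← Real.smul_map_volume_mul_left hR.ne']
  rw [lintegral_smul_measure, abs_of_pos hR, lintegral_map hF (by fun_prop), smul_eq_mul]

lemma gg_ZN {s : ℝ} (hs : -1 < s) (k : ℕ) (hk : |s| + 2 ≤ ((k + 2 : ℕ) : ℝ)) :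
    ∃ C : ℝ, 0 ≤ C ∧ ∀ j : ℕ,
      ZN s (gg k j) ≤ ENNReal.ofReal (C * (1 + j) ^ (s + 1 - ((k + 2 : ℕ) : ℝ))) := by
  obtain ⟨C, hC, h⟩ := gg_bound k
  set n : ℝ := ((k + 2 : ℕ) : ℝ) with hn
  set W := ∫⁻ y : ℝ, ENNReal.ofReal (|y| ^ s * (1 + |y|) ^ (-n)) with hW
  have hWt : W < ⊤ := wint_lt_top hs hk
  refine ⟨C * π * W.toReal, by positivity, fun j => ?_⟩
  have hmeas := ZN_integrand_measurable s (gg_differentiable k j)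
  rw [ZN, lint_complex hmeas]
  have hj : (0:ℝ) ≤ j := Nat.cast_nonneg j
  have inner : ∀ y : ℝ, ∫⁻ x : ℝ, ENNReal.ofReal (wt s (x + y * I)) * ‖gg k j (x + y * I)‖ₑ ≤
      ENNReal.ofReal (C * π) * ENNReal.ofReal (|y| ^ s * (1 + j + |y|) ^ (-n)) := by
    intro y
    set R : ℝ := 1 + j + |y| with hR
    have hR0 : 0 < R := by have := abs_nonneg y; positivity
    have b1 : ∀ x : ℝ, ENNReal.ofReal (wt s (x + y * I)) * ‖gg k j (x + y * I)‖ₑ ≤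
        ENNReal.ofReal (|y| ^ s * C * (R ^ (k + 1))⁻¹) * ENNReal.ofReal ((R ^ 2 + x ^ 2)⁻¹) := by
      intro x
      rw [← ofReal_norm, ← ENNReal.ofReal_mul (wt_nonneg _ _), ← ENNReal.ofReal_mul (by positivity)]
      apply ENNReal.ofReal_le_ofReal
      have hh := h j x y
      have : Real.exp (-π * |y|) * ‖gg k j (x + y * I)‖ ≤ C / ((R ^ 2 + x ^ 2) * R ^ (k + 1)) := by
        rw [le_div_iff₀ (by positivity)]; exact hh
      calc wt s (x + y * I) * ‖gg k j (x + y * I)‖ = |y| ^ s * (Real.exp (-π * |y|) * ‖gg k j (x + y * I)‖) := by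
            simp [wt]; ring
        _ ≤ |y| ^ s * (C / ((R ^ 2 + x ^ 2) * R ^ (k + 1))) := mul_le_mul_of_nonneg_left this (by positivity)
        _ = _ := by rw [div_eq_mul_inv, mul_inv]; ring
    refine (lintegral_mono b1).trans ?_
    rw [lintegral_const_mul _ (by fun_prop), lint_scale hR0 (by fun_prop)]
    have b2 : ∀ t : ℝ, ENNReal.ofReal ((R ^ 2 + (R * t) ^ 2)⁻¹) =
        ENNReal.ofReal ((R ^ 2)⁻¹) * ENNReal.ofReal ((1 + t ^ 2)⁻¹) := by
      intro t
      rw [← ENNReal.ofReal_mul (by positivity), ← mul_inv]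
      congr 2; ring
    simp_rw [b2]
    rw [lintegral_const_mul _ (by fun_prop), ← ofReal_integral_eq_lintegral_ofReal
      integrable_inv_one_add_sq (Filter.Eventually.of_forall fun t => by positivity),
      integral_univ_inv_one_add_sq, ← ENNReal.ofReal_mul (by positivity),
      ← ENNReal.ofReal_mul (by positivity), ← ENNReal.ofReal_mul (by positivity),
      ← ENNReal.ofReal_mul (by positivity)]
    apply ENNReal.ofReal_le_ofReal
    apply le_of_eq
    rw [Real.rpow_neg hR0.le, hn, Real.rpow_natCast]
    field_simp
    ring
  refine (lintegral_mono inner).trans ?_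
  have m2 : Measurable fun y : ℝ => ENNReal.ofReal (|y| ^ s * (1 + j + |y|) ^ (-n)) := by
    have : Measurable fun y : ℝ => |y| := measurable_id.abs
    exact (((this.pow_const s)).mul ((this.const_add _).pow_const _)).ennreal_ofReal
  have hJ : (0:ℝ) < 1 + j := by positivity
  rw [lintegral_const_mul _ m2, lint_scale hJ m2]
  have b3 : ∀ t : ℝ, ENNReal.ofReal (|(1 + (j:ℝ)) * t| ^ s * (1 + j + |(1 + (j:ℝ)) * t|) ^ (-n)) =
      ENNReal.ofReal ((1 + j) ^ (s - n)) * ENNReal.ofReal (|t| ^ s * (1 + |t|) ^ (-n)) := by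
    intro t
    rw [← ENNReal.ofReal_mul (by positivity)]
    congr 1
    rw [abs_mul, abs_of_pos hJ, show 1 + (j:ℝ) + (1 + j) * |t| = (1 + j) * (1 + |t|) by ring,
      Real.mul_rpow hJ.le (abs_nonneg _), Real.mul_rpow hJ.le (by positivity),
      sub_eq_add_neg, Real.rpow_add hJ]
    ring
  simp_rw [b3]
  have m3 : Measurable fun y : ℝ => ENNReal.ofReal (|y| ^ s * (1 + |y|) ^ (-n)) := by
    have : Measurable fun y : ℝ => |y| := measurable_id.abs
    exact (((this.pow_const s)).mul ((this.const_add _).pow_const _)).ennreal_ofReal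
  rw [lintegral_const_mul _ m3, ← hW, ← ENNReal.ofReal_toReal hWt.ne,
    ENNReal.toReal_ofReal ENNReal.toReal_nonneg,
    ← ENNReal.ofReal_mul (by positivity), ← ENNReal.ofReal_mul (by positivity), ← ENNReal.ofReal_mul (by positivity)]
  apply ENNReal.ofReal_le_ofReal
  apply le_of_eq
  rw [show s + 1 - n = 1 + (s - n) by ring, Real.rpow_add hJ, Real.rpow_one]
  ring

end Part7

section Part8
open MeasureTheory Real Complex
open scoped ENNReal NNReal

lemma fourier_rec {F : ℝ → ℂ} (hF : Continuous F) (h0 : F 0 = 0) (h1 : F 1 = 0) {co : ℤ → ℂ}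
    (hco : ∀ m, co m = ∫ τ in (0:ℝ)..1, F τ * cexp (-(2 * π * I * m * τ))) (hs : Summable co)
    {τ : ℝ} (hτ : τ ∈ Set.Ioc (0:ℝ) 1) :
    HasSum (fun m : ℤ => co m * cexp (2 * π * I * m * τ)) (F τ) := by
  have hc : Continuous (AddCircle.liftIco (1:ℝ) 0 F) :=
    AddCircle.liftIco_continuous (by simp [h0, h1]) hF.continuousOn
  have hcoef : ∀ m, fourierCoeff (AddCircle.liftIco (1:ℝ) 0 F) m = co m := by
    intro m
    rw [fourierCoeff_liftIco_eq, fourierCoeffOn_eq_integral, hco]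
    simp only [zero_add, sub_zero, div_one, one_smul]
    apply intervalIntegral.integral_congr
    intro x _
    simp only [fourier_coe_apply, smul_eq_mul]
    rw [mul_comm]
    congr 2
    push_cast
    simp
  have key : ∀ t ∈ Set.Ico (0:ℝ) 1, HasSum (fun m : ℤ => co m * cexp (2 * π * I * m * t)) (F t) := by
    intro t ht
    have := has_pointwise_sum_fourier_series_of_summable
      (f := ⟨AddCircle.liftIco (1:ℝ) 0 F, hc⟩) (by
        simp only [ContinuousMap.coe_mk]
        exact hs.congr fun m => (hcoef m).symm) (t : AddCircle (1:ℝ))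
    simp only [ContinuousMap.coe_mk, hcoef, fourier_coe_apply, smul_eq_mul] at this
    rw [AddCircle.liftIco_coe_apply (by simpa using ht)] at this
    simpa using this
  rcases hτ.2.lt_or_eq with h | h
  · exact key τ ⟨hτ.1.le, h⟩
  · have := key 0 (by simp)
    rw [h, h1]
    rw [h0] at this
    refine this.congr_fun ?_ |> id
    intro m
    have e : cexp (2 * π * I * m * (1:ℝ)) = 1 := by
      rw [← Complex.exp_int_mul_two_pi_mul_I m]; congr 1; push_cast; ring
    rw [e]; simp

lemma half_summable : Summable fun m : ℤ => (((m:ℝ) + 1/2) ^ 2)⁻¹ := by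
  have := (Real.summable_one_div_int_add_rpow (1/2) 2).2 (by norm_num)
  refine this.congr fun m => ?_
  rw [one_div, Real.rpow_two, sq_abs]

lemma qq_summable (k j : ℕ) (z : ℂ) : Summable fun m : ℤ => ‖qq k j (z - m)‖ := by
  obtain ⟨C, hC, h⟩ := gg_bound k
  have hx : ∃ x y : ℝ, z = x + y * I := ⟨z.re, z.im, (Complex.re_add_im z).symm⟩
  obtain ⟨x, y, rfl⟩ := hx
  set K := Real.exp (-π * |y|) * Real.exp (π * y) with hK
  have hK0 : 0 < K := by positivity
  refine Summable.of_nonneg_of_le (fun _ => norm_nonneg _) (fun m => ?_)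
    (half_summable.mul_left (K⁻¹ * C * (2 * (1 + (x + 1/2) ^ 2))))
  have hh := h j (x - m) y
  have e : ((x - m : ℝ) : ℂ) + y * I = x + y * I - m := by push_cast; ring
  rw [e, gg, norm_mul, Complex.norm_exp] at hh
  have e2 : (-I * π * (x + y * I - m)).re = π * y := by simp
  rw [e2, ← mul_assoc (Real.exp _), ← hK] at hh
  set q := ‖qq k j (x + y * I - m)‖ with hq
  have hj : (0:ℝ) ≤ j := Nat.cast_nonneg j
  set R := 1 + (j:ℝ) + |y| with hR
  have hR1 : 1 ≤ R := by have := abs_nonneg y; linarith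
  have m0 : ((m:ℝ) + 1/2) ≠ 0 := by
    intro h
    have : (2 * m + 1 : ℤ) = 0 := by
      have : (2 * m + 1 : ℝ) = 0 := by linarith
      exact_mod_cast this
    omega
  have i1 : K * q * (1 + (x - m) ^ 2) ≤ C := by
    refine le_trans ?_ hh
    apply mul_le_mul_of_nonneg_left _ (by positivity)
    have a1 : 1 ≤ R ^ 2 := one_le_pow₀ hR1
    have a2 : 1 ≤ R ^ (k + 1) := one_le_pow₀ hR1
    calc 1 + (x - m) ^ 2 ≤ (R ^ 2 + (x - m) ^ 2) * 1 := by linarith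
      _ ≤ _ := mul_le_mul_of_nonneg_left a2 (by positivity)
  have i2 : ((m:ℝ) + 1/2) ^ 2 ≤ 2 * (1 + (x + 1/2) ^ 2) * (1 + (x - m) ^ 2) := by
    nlinarith [sq_nonneg ((x - m) + (x + 1/2)), mul_nonneg (sq_nonneg (x + 1/2)) (sq_nonneg (x - m))]
  have p : 0 < ((m:ℝ) + 1/2) ^ 2 := by positivity
  rw [← div_eq_mul_inv, le_div_iff₀ p]
  calc q * ((m:ℝ) + 1/2) ^ 2 ≤ q * (2 * (1 + (x + 1/2) ^ 2) * (1 + (x - m) ^ 2)) :=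
        mul_le_mul_of_nonneg_left i2 (norm_nonneg _)
    _ = K⁻¹ * (2 * (1 + (x + 1/2) ^ 2)) * (K * q * (1 + (x - m) ^ 2)) := by
        field_simp
    _ ≤ K⁻¹ * (2 * (1 + (x + 1/2) ^ 2)) * C := mul_le_mul_of_nonneg_left i1 (by positivity)
    _ = _ := by ring

/-- Fourier-Laplace transform of the density. -/
noncomputable def hh (H : ℝ → ℂ) (z : ℂ) : ℂ := ∫ τ in (0:ℝ)..1, H τ * cexp (2 * π * I * z * τ)

lemma inner_rec (k j : ℕ) {H : ℝ → ℂ} (hH : Continuous H) (z : ℂ) :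
    HasSum (fun m : ℤ => hh H (m + (j + 1) * I) * qq k j (z - m))
      (∫ τ in (0:ℝ)..1, H τ * cexp (2 * π * I * z * τ) *
        (Real.exp (-4 * π * τ) ^ j * (th τ ^ (k + 2) * chi τ) : ℝ)) := by
  have cu := uu_continuous k
  set F : ℝ → ℂ := fun τ => cexp ((2 * π * I * z - 2 * π * j) * τ) * uu k τ with hF
  have cF : Continuous F := by rw [hF]; fun_prop
  have hq := qq_summable k j z
  have hrec := fun (τ : ℝ) (hτ : τ ∈ Set.Ioc (0:ℝ) 1) =>
    fourier_rec cF (by simp [hF, uu, th_zero]) (by simp [hF, uu, bb_zero 1 (by norm_num)])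
      (co := fun m : ℤ => qq k j (z - m)) (fun m => by
        rw [qq, LI]
        apply intervalIntegral.integral_congr
        intro τ _
        simp only [hF]
        rw [mul_right_comm (cexp _) (uu k τ : ℂ), ← Complex.exp_add]
        congr 2; ring) hq.of_norm hτ
  obtain ⟨D, hD⟩ := (isCompact_Icc (a := (0:ℝ)) (b := 1)).exists_bound_of_continuousOn hH.continuousOn
  have D0 : 0 ≤ D := (norm_nonneg _).trans (hD 0 (by simp))
  have main := intervalIntegral.hasSum_integral_of_dominated_convergence (μ := volume) (a := (0:ℝ)) (b := 1)
    (F := fun (m : ℤ) (τ : ℝ) => H τ * cexp (2 * π * I * (m + (j + 1) * I) * τ) * qq k j (z - m))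
    (f := fun τ : ℝ => H τ * cexp (2 * π * I * z * τ) *
        (Real.exp (-4 * π * τ) ^ j * (th τ ^ (k + 2) * chi τ) : ℝ))
    (fun m _ => D * ‖qq k j (z - m)‖)
    (fun m => Continuous.aestronglyMeasurable (by fun_prop))
    (fun m => Filter.Eventually.of_forall fun τ hτ => by
      rw [Set.uIoc_of_le zero_le_one] at hτ
      rw [norm_mul, norm_mul]
      apply mul_le_mul_of_nonneg_right _ (norm_nonneg _)
      have e : ‖cexp (2 * π * I * (m + (j + 1) * I) * τ)‖ ≤ 1 := by
        rw [Complex.norm_exp, Real.exp_le_one_iff]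
        have : (2 * π * I * (m + (j + 1) * I) * τ).re = - (2 * π * (j + 1) * τ) := by
          simp
        rw [this]
        have := hτ.1
        have : 0 ≤ 2 * π * (j + 1) * τ := by positivity
        linarith
      calc _ ≤ D * 1 := mul_le_mul (hD τ ⟨hτ.1.le, hτ.2⟩) e (norm_nonneg _) D0
        _ = D := mul_one D)
    (Filter.Eventually.of_forall fun τ _ => hq.mul_left D)
    (by simp)
    (Filter.Eventually.of_forall fun τ hτ => by
      rw [Set.uIoc_of_le zero_le_one] at hτ
      have := (hrec τ hτ).mul_left (H τ * cexp (-(2 * π * (j + 1) * τ)))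
      have e2 : H τ * cexp (-(2 * π * (j + 1) * τ)) * F τ = H τ * cexp (2 * π * I * z * τ) *
          (Real.exp (-4 * π * τ) ^ j * (th τ ^ (k + 2) * chi τ) : ℝ) := by
        simp only [hF, uu, bb]
        push_cast
        rw [← Complex.exp_nat_mul]
        have : cexp (2 * π * I * z * τ) * cexp (j * (-4 * π * τ)) = cexp (-(2 * π * (j + 1) * τ)) * cexp ((2 * π * I * z - 2 * π * j) * τ) * cexp (2 * π * τ) := by
          rw [← Complex.exp_add, ← Complex.exp_add, ← Complex.exp_add]; congr 1; ring
        linear_combination (-(H τ * th τ ^ (k + 2) * chi τ)) * this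
      rw [e2] at this
      refine this.congr_fun fun m => ?_
      · have : cexp (2 * π * I * (m + (j + 1) * I) * τ) = cexp (-(2 * π * (j + 1) * τ)) * cexp (2 * π * I * m * τ) := by
          rw [← Complex.exp_add]; congr 1
          linear_combination (2 * π * (j + 1) * τ) * Complex.I_mul_I
        rw [this]; ring)
  refine main.congr_fun ?_ |> id
  intro m
  rw [hh, intervalIntegral.integral_mul_const]

lemma outer_rec (k : ℕ) {H : ℝ → ℂ} (hH : Continuous H) (z : ℂ) :
    HasSum (fun j : ℕ => ((j + (k + 1)).choose (k + 1) : ℂ) * ∫ τ in (0:ℝ)..1, H τ * cexp (2 * π * I * z * τ) *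
        (Real.exp (-4 * π * τ) ^ j * (th τ ^ (k + 2) * chi τ) : ℝ))
      (∫ τ in (0:ℝ)..1, H τ * cexp (2 * π * I * z * τ) * chi τ) := by
  have cth := th_contDiff.continuous
  have cchi := chi_contDiff.continuous
  set G : ℝ → ℂ := fun τ => H τ * cexp (2 * π * I * z * τ) * chi τ with hG
  have cG : Continuous G := by rw [hG]; fun_prop
  have geo : ∀ τ ∈ Set.Ioc (0:ℝ) 1, HasSum (fun j : ℕ => ((j + (k + 1)).choose (k + 1) : ℝ) * Real.exp (-4 * π * τ) ^ j * th τ ^ (k + 2)) 1 := by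
    intro τ hτ
    have lt : Real.exp (-4 * π * τ) < 1 := by
      rw [Real.exp_lt_one_iff]; have := hτ.1; nlinarith [mul_pos pi_pos this]
    have := (hasSum_choose_mul_geometric_of_norm_lt_one (k + 1) (r := Real.exp (-4 * π * τ)) (by
      rw [Real.norm_eq_abs, abs_of_pos (Real.exp_pos _)]; exact lt)).mul_right (th τ ^ (k + 2))
    have e : 1 / (1 - Real.exp (-4 * π * τ)) ^ (k + 1 + 1) * th τ ^ (k + 2) = 1 := by
      rw [← th, one_div, inv_mul_cancel₀]
      have : 0 < th τ := by rw [th]; linarith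
      positivity
    rwa [e] at this
  have main := intervalIntegral.hasSum_integral_of_dominated_convergence (μ := volume) (a := (0:ℝ)) (b := 1)
    (F := fun (j : ℕ) (τ : ℝ) => ((j + (k + 1)).choose (k + 1) : ℂ) * (H τ * cexp (2 * π * I * z * τ) *
        (Real.exp (-4 * π * τ) ^ j * (th τ ^ (k + 2) * chi τ) : ℝ)))
    (f := G)
    (fun j τ => ‖G τ‖ * (((j + (k + 1)).choose (k + 1) : ℝ) * Real.exp (-4 * π * τ) ^ j * th τ ^ (k + 2)))
    (fun m => Continuous.aestronglyMeasurable (by fun_prop))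
    (fun j => Filter.Eventually.of_forall fun τ hτ => by
      rw [Set.uIoc_of_le zero_le_one] at hτ
      have : 0 ≤ th τ := th_nonneg hτ.1.le
      simp only [hG, norm_mul, Complex.norm_natCast, norm_real, Real.norm_eq_abs, abs_pow,
        abs_of_nonneg this, Real.abs_exp]
      apply le_of_eq; ring)
    (Filter.Eventually.of_forall fun τ hτ => by
      rw [Set.uIoc_of_le zero_le_one] at hτ
      exact (geo τ hτ).summable.mul_left _)
    (by
      refine IntervalIntegrable.congr (f := fun τ => ‖G τ‖) ?_ (cG.norm.intervalIntegrable _ _)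
      intro τ hτ
      rw [Set.uIoc_of_le zero_le_one] at hτ
      simp only [tsum_mul_left, (geo τ hτ).tsum_eq, mul_one])
    (Filter.Eventually.of_forall fun τ hτ => by
      rw [Set.uIoc_of_le zero_le_one] at hτ
      have := (Complex.hasSum_ofReal.2 (geo τ hτ)).mul_left (G τ)
      rw [Complex.ofReal_one, mul_one] at this
      refine this.congr_fun fun j => ?_
      simp only [hG]; push_cast; ring)
  refine main.congr_fun ?_ |> id
  intro m
  rw [intervalIntegral.integral_const_mul]

lemma upper_rec (k : ℕ) {H : ℝ → ℂ} (hH : Continuous H) (z : ℂ) {S : ℂ}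
    (hS : HasSum (fun x : ℕ × ℤ => ((x.1 + (k + 1)).choose (k + 1) : ℂ) *
      (hh H (x.2 + (x.1 + 1) * I) * qq k x.1 (z - x.2))) S) :
    S = ∫ τ in (0:ℝ)..1, H τ * cexp (2 * π * I * z * τ) * chi τ := by
  have h1 := hS.prod_fiberwise (g := fun j : ℕ => ((j + (k + 1)).choose (k + 1) : ℂ) *
    ∫ τ in (0:ℝ)..1, H τ * cexp (2 * π * I * z * τ) *
        (Real.exp (-4 * π * τ) ^ j * (th τ ^ (k + 2) * chi τ) : ℝ)) (by
      intro j
      exact (inner_rec k j hH z).mul_left _)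
  exact h1.unique (outer_rec k hH z)

end Part8

section Part9
open MeasureTheory Real Complex
open scoped ENNReal NNReal

/-- sign -/
def sg (b : Bool) : ℂ := if b then 1 else -1

/-- lattice points -/
noncomputable def pt (x : Bool × ℕ × ℤ) : ℂ := sg x.1 * (x.2.2 + (x.2.1 + 1) * I)

lemma pt_im (x : Bool × ℕ × ℤ) : |(pt x).im| = x.2.1 + 1 := by
  obtain ⟨b, j, m⟩ := x
  have : |(j:ℝ) + 1| = j + 1 := abs_of_nonneg (by positivity)
  cases b
  · simp only [pt, sg]
    rw [← this, ← abs_neg ((j:ℝ) + 1)]; simp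
  · simp [pt, sg, this]

lemma int_dist {a b : ℤ} (h : a ≠ b) : (1:ℝ) ≤ |(a:ℝ) - b| := by
  have : 1 ≤ |a - b| := Int.one_le_abs (sub_ne_zero.2 h)
  exact_mod_cast this

lemma pt_eq (x : Bool × ℕ × ℤ) : ∃ a b : ℤ, (pt x).re = a ∧ (pt x).im = b ∧
    a = (if x.1 then 1 else -1) * x.2.2 ∧ b = (if x.1 then 1 else -1) * (x.2.1 + 1) := by
  obtain ⟨b, j, m⟩ := x
  refine ⟨_, _, ?_, ?_, rfl, rfl⟩ <;> cases b <;> simp [pt, sg]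

lemma pt_sep (x y : Bool × ℕ × ℤ) (h : x ≠ y) : 1 ≤ dist (pt x) (pt y) := by
  obtain ⟨a, b, ha, hb, ha2, hb2⟩ := pt_eq x
  obtain ⟨a', b', ha', hb', ha2', hb2'⟩ := pt_eq y
  rw [Complex.dist_eq]
  by_cases h1 : a = a'
  · by_cases h2 : b = b'
    · exfalso; apply h
      obtain ⟨s, j, m⟩ := x
      obtain ⟨s', j', m'⟩ := y
      simp only at *
      cases s <;> cases s' <;> simp at * <;> omega
    · refine le_trans ?_ (Complex.abs_im_le_norm _)
      rw [sub_im, hb, hb']; exact int_dist h2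
  · refine le_trans ?_ (Complex.abs_re_le_norm _)
    rw [sub_re, ha, ha']; exact int_dist h1

/-- normalised kernels -/
noncomputable def kr (s : ℝ) (k : ℕ) (x : Bool × ℕ × ℤ) (z : ℂ) : ℂ :=
  ((((x.2.1 + (k + 1)).choose (k + 1) : ℝ) * (1 + x.2.1 : ℝ) ^ (-s) : ℝ) : ℂ) * gg k x.2.1 (sg x.1 * z - x.2.2)

lemma kr_differentiable (s : ℝ) (k : ℕ) (x : Bool × ℕ × ℤ) : Differentiable ℂ (kr s k x) := by
  have : Differentiable ℂ fun z : ℂ => gg k x.2.1 (sg x.1 * z - x.2.2) :=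
    (gg_differentiable k x.2.1).comp (by fun_prop)
  exact this.const_mul _

lemma kr_ZN {s : ℝ} (hs : -1 < s) (k : ℕ) (hk : |s| + 2 ≤ ((k + 2 : ℕ) : ℝ)) :
    ∃ C : ℝ≥0, ∀ x, ZN s (kr s k x) ≤ C := by
  obtain ⟨C, hC, h⟩ := gg_ZN hs k hk
  refine ⟨Real.toNNReal ((k + 2) ^ (k + 1) * C), fun x => ?_⟩
  obtain ⟨b, j, m⟩ := x
  have e1 : ZN s (fun z : ℂ => gg k j (sg b * z - m)) = ZN s (gg k j) := by
    have := ZN_translate s (gg k j) m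
    push_cast at this
    cases b
    · rw [← this, ← ZN_neg]; simp [sg]
    · rw [← this]; simp [sg]
  have e2 : kr s k (b, j, m) = ((((j + (k + 1)).choose (k + 1) : ℝ) * (1 + j : ℝ) ^ (-s) : ℝ) : ℂ) •
      (fun z : ℂ => gg k j (sg b * z - m)) := by
    ext z; simp [kr]
  rw [e2, ZN_smul, e1]
  have hj : (0:ℝ) < 1 + j := by positivity
  have p0 : 0 ≤ ((j + (k + 1)).choose (k + 1) : ℝ) * (1 + j : ℝ) ^ (-s) := by positivity
  have e3 : ‖((((j + (k + 1)).choose (k + 1) : ℝ) * (1 + j : ℝ) ^ (-s) : ℝ) : ℂ)‖ₑ =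
      ENNReal.ofReal (((j + (k + 1)).choose (k + 1) : ℝ) * (1 + j : ℝ) ^ (-s)) := by
    rw [← ofReal_norm, norm_real, Real.norm_eq_abs, abs_of_nonneg p0]
  rw [e3]
  refine (mul_le_mul_right (h j) _).trans ?_
  rw [← ENNReal.ofReal_mul p0]
  apply ENNReal.ofReal_le_ofReal
  have ch : ((j + (k + 1)).choose (k + 1) : ℝ) ≤ (k + 2) ^ (k + 1) * (1 + j) ^ (k + 1) := by
    have c1 : ((j + (k + 1)).choose (k + 1) : ℝ) ≤ ((j + (k + 1) : ℕ) : ℝ) ^ (k + 1) := by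
      exact_mod_cast Nat.choose_le_pow (j + (k + 1)) (k + 1)
    refine c1.trans ?_
    rw [← mul_pow]
    apply pow_le_pow_left₀ (by positivity)
    push_cast
    have : (0:ℝ) ≤ k * j := by positivity
    nlinarith
  have rp : (1 + j : ℝ) ^ (k + 1) * (1 + j : ℝ) ^ (-s) * (1 + j : ℝ) ^ (s + 1 - ((k + 2 : ℕ) : ℝ)) = 1 := by
    rw [← Real.rpow_natCast, ← Real.rpow_add hj, ← Real.rpow_add hj]
    rw [show ((k + 1 : ℕ) : ℝ) + -s + (s + 1 - ((k + 2 : ℕ) : ℝ)) = 0 by push_cast; ring, Real.rpow_zero]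
  calc _ ≤ (k + 2) ^ (k + 1) * (1 + j) ^ (k + 1) * (1 + j : ℝ) ^ (-s) * (C * (1 + j) ^ (s + 1 - ((k + 2 : ℕ) : ℝ))) := by
        apply mul_le_mul_of_nonneg_right _ (by positivity)
        exact mul_le_mul_of_nonneg_right ch (by positivity)
    _ = (k + 2) ^ (k + 1) * C * ((1 + j : ℝ) ^ (k + 1) * (1 + j : ℝ) ^ (-s) * (1 + j : ℝ) ^ (s + 1 - ((k + 2 : ℕ) : ℝ))) := by ring
    _ = _ := by rw [rp, mul_one]

/-- the two densities -/
def HB (H : ℝ → ℂ) (b : Bool) (τ : ℝ) : ℂ := if b then H τ else H (1 - τ)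

lemma HB_cont {H : ℝ → ℂ} (hH : Continuous H) (b : Bool) : Continuous (HB H b) := by
  cases b
  · exact hH.comp (continuous_const.sub continuous_id)
  · exact hH

lemma flip_int (H : ℝ → ℂ) (φ : ℝ → ℂ) (z : ℂ) :
    ∫ τ in (0:ℝ)..1, H (1 - τ) * cexp (2 * π * I * (-z) * τ) * φ (1 - τ) =
      cexp (-(2 * π * I * z)) * ∫ τ in (0:ℝ)..1, H τ * cexp (2 * π * I * z * τ) * φ τ := by
  have := intervalIntegral.integral_comp_sub_left (a := (0:ℝ)) (b := 1)
    (fun τ : ℝ => H τ * cexp (2 * π * I * z * τ) * φ τ) 1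
  simp only [sub_self, sub_zero] at this
  rw [← this, ← intervalIntegral.integral_const_mul]
  congr 1; ext τ
  have : cexp (2 * π * I * (-z) * τ) = cexp (-(2 * π * I * z)) * cexp (2 * π * I * z * ((1 - τ : ℝ) : ℂ)) := by
    rw [← Complex.exp_add]; congr 1; push_cast; ring
  rw [this]; ring

lemma f_sg {f : ℂ → ℂ} {H : ℝ → ℂ} (hf : ∀ z, f z = cexp (-I * π * z) * hh H z) (b : Bool) (w : ℂ) :
    f (sg b * w) = cexp (-I * π * w) * hh (HB H b) w := by
  cases b
  · have e := flip_int H (fun _ => 1) (-w)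
    simp only [mul_one, neg_neg] at e
    have e2 : hh (HB H false) w = cexp (-(2 * π * I * -w)) * hh H (-w) := by
      rw [hh, hh, ← e]; simp [HB]
    rw [e2, hf, ← mul_assoc (cexp (-I * π * w)), ← Complex.exp_add]
    simp only [sg]
    simp only [Bool.false_eq_true, if_false, neg_one_mul]
    congr 2; ring
  · simp only [sg, if_true, one_mul, hf w]
    congr 1

lemma term_eq {s : ℝ} (k : ℕ) {f : ℂ → ℂ} {H : ℝ → ℂ}
    (hf : ∀ z, f z = cexp (-I * π * z) * hh H z) (b : Bool) (x : ℕ × ℤ) (z : ℂ) :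
    (wt s (pt (b, x)) : ℂ) * f (pt (b, x)) * kr s k (b, x) z =
      cexp (-I * π * (sg b * z)) * (((x.1 + (k + 1)).choose (k + 1) : ℂ) *
      (hh (HB H b) (x.2 + (x.1 + 1) * I) * qq k x.1 (sg b * z - x.2))) := by
  obtain ⟨j, m⟩ := x
  have hj : (0:ℝ) < 1 + j := by positivity
  have r1 : (1 + j : ℝ) ^ s * (1 + j : ℝ) ^ (-s) = 1 := by rw [← Real.rpow_add hj]; simp
  have r1c : (((1 + j : ℝ) ^ s : ℝ) : ℂ) * (((1 + j : ℝ) ^ (-s) : ℝ) : ℂ) = 1 := by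
    rw [← ofReal_mul, r1, ofReal_one]
  have hw : (wt s (pt (b, j, m)) : ℂ) = cexp (-(π * (j + 1))) * (((1 + j : ℝ) ^ s : ℝ) : ℂ) := by
    rw [wt, pt_im]; push_cast; rw [add_comm (j:ℂ), add_comm (j:ℝ)]; congr 2; ring
  have hfp : f (pt (b, j, m)) = cexp (-I * π * (m + (j + 1) * I)) * hh (HB H b) (m + (j + 1) * I) := f_sg hf b _
  have ex : cexp (-(π * (j + 1))) * cexp (-I * π * (m + (j + 1) * I)) * cexp (-I * π * (sg b * z - m)) =
      cexp (-I * π * (sg b * z)) := by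
    rw [← Complex.exp_add, ← Complex.exp_add]; congr 1
    linear_combination (-π * (j + 1)) * Complex.I_mul_I
  rw [hw, hfp, kr, gg]
  simp only [ofReal_mul, ofReal_natCast]
  rw [← ex]
  linear_combination (cexp (-(π * (j + 1))) * cexp (-I * π * (m + (j + 1) * I)) * cexp (-I * π * (sg b * z - m)) * ((j + (k + 1)).choose (k + 1) : ℂ) *
      (hh (HB H b) (m + (j + 1) * I) * qq k j (sg b * z - m))) * r1c

lemma full_rec {s : ℝ} (k : ℕ) {f : ℂ → ℂ} {H : ℝ → ℂ} (hH : Continuous H)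
    (hf : ∀ z, f z = cexp (-I * π * z) * hh H z) (z : ℂ)
    (hS : Summable fun x : Bool × ℕ × ℤ => (wt s (pt x) : ℂ) * f (pt x) * kr s k x z) :
    ∑' x : Bool × ℕ × ℤ, (wt s (pt x) : ℂ) * f (pt x) * kr s k x z = f z := by
  have key : ∀ b, ∑' x : ℕ × ℤ, (wt s (pt (b, x)) : ℂ) * f (pt (b, x)) * kr s k (b, x) z =
      cexp (-I * π * (sg b * z)) * ∫ τ in (0:ℝ)..1, HB H b τ * cexp (2 * π * I * (sg b * z) * τ) * chi τ := by
    intro b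
    have h1 := (hS.prod_factor b)
    simp_rw [term_eq (s := s) k hf b] at h1 ⊢
    have h2 := (summable_mul_left_iff (Complex.exp_ne_zero _)).1 h1
    rw [tsum_mul_left]
    congr 1
    exact upper_rec k (HB_cont hH b) _ h2.hasSum
  rw [hS.tsum_prod, tsum_bool, key, key, hf z]
  have cchi := chi_contDiff.continuous
  have e := flip_int H (fun τ => (chi (1 - τ) : ℂ)) z
  simp only [sub_sub_cancel] at e
  simp only [HB, sg, Bool.false_eq_true, if_false, if_true, one_mul, neg_one_mul]
  rw [e, ← mul_assoc, ← Complex.exp_add, show -I * π * -z + -(2 * π * I * z) = -I * π * z by ring,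
    ← mul_add, hh, ← intervalIntegral.integral_add (Continuous.intervalIntegrable (by fun_prop) _ _)
      (Continuous.intervalIntegrable (by fun_prop) _ _)]
  congr 2; ext τ
  rw [← mul_add, ← ofReal_add, add_comm, chi_add]; simp

theorem coretract {s : ℝ} (hs : -1 < s) : ∃ (A : Zsub s →ₗ[ℂ] E1) (B : E1 →ₗ[ℂ] Zsub s) (K : ℝ),
    0 ≤ K ∧ (∀ f, ‖A f‖ ≤ K * (ZN s f.1).toReal) ∧ (∀ a, (ZN s (B a).1).toReal ≤ K * ‖a‖) ∧
    ∀ f, B (A f) = f := by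
  obtain ⟨k, hk⟩ := exists_nat_ge (|s| + 2)
  have hk2 : |s| + 2 ≤ ((k + 2 : ℕ) : ℝ) := by push_cast; linarith
  obtain ⟨e⟩ : Nonempty (ℕ ≃ Bool × ℕ × ℤ) := nonempty_equiv_of_countable
  obtain ⟨C, hC⟩ := kr_ZN hs k hk2
  obtain ⟨B, hB1, hB2, hB3⟩ := synth s (fun n => kr s k (e n)) (fun n => kr_differentiable s k _) C
    (fun n => hC _)
  obtain ⟨A, K, hK, hA1, hA2⟩ := analysis s (fun n => pt (e n)) (fun n => by
      rw [pt_im]; have : (0:ℝ) ≤ (e n).2.1 := Nat.cast_nonneg _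
      linarith)
    (fun m n hmn => pt_sep _ _ (e.injective.ne hmn)) (fun n => (wt s (pt (e n)) : ℂ)) 1 zero_le_one
    (fun n => by rw [norm_real, Real.norm_eq_abs, abs_of_nonneg (wt_nonneg _ _), one_mul])
  refine ⟨A, B, K + C, by positivity, fun f => (hA2 f).trans ?_, fun a => (hB3 a).trans ?_, fun f => ?_⟩
  · apply mul_le_mul_of_nonneg_right _ ENNReal.toReal_nonneg
    have := C.2; simp
  · apply mul_le_mul_of_nonneg_right _ (norm_nonneg _)
    linarith
  · obtain ⟨H, hH, hf⟩ := paley_wiener hs f.2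
    apply Subtype.ext
    ext z
    have h1 := hB1 (A f) z
    rw [hB2]
    simp only [hA1] at h1 ⊢
    have h2 := (e.summable_iff (f := fun x => (wt s (pt x) : ℂ) * f.1 (pt x) * kr s k x z)).1 h1
    rw [e.tsum_eq (fun x => (wt s (pt x) : ℂ) * f.1 (pt x) * kr s k x z)]
    exact full_rec k hH hf z h2

end Part9

/-- **`Eᵖ_c ≈ ℓ¹`.** For `0 < p < 1`, the space `Z` of entire functions with finite
norm `∫_ℂ e^{-π|Im z|} |Im z|^{1/p-2} |f(z)| dA(z)` (the Banach envelope of `Eᵖ`) is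
isomorphic to `ℓ¹`: there is a linear map `T`, bijective from `Z` onto `ℓ¹(ℕ, ℂ)`,
with `C⁻¹ ‖f‖_Z ≤ ‖Tf‖_{ℓ¹} ≤ C ‖f‖_Z`. -/
theorem Z_isomorphic_to_ell1 (p : ℝ) (hp0 : 0 < p) (hp1 : p < 1) :
    ∃ (T : (ℂ → ℂ) →ₗ[ℂ] (ℕ → ℂ)) (C : ℝ), 0 < C ∧
      Set.InjOn T {f : ℂ → ℂ | MemZ p f} ∧
      (∀ a : ℕ → ℂ, Summable (fun n => ‖a n‖) → ∃ f : ℂ → ℂ, MemZ p f ∧ T f = a) ∧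
      (∀ f : ℂ → ℂ, MemZ p f →
        Summable (fun n => ‖T f n‖) ∧
        C⁻¹ * (ZNorm p f).toReal ≤ ∑' n : ℕ, ‖T f n‖ ∧
        (∑' n : ℕ, ‖T f n‖) ≤ C * (ZNorm p f).toReal) := by
  have hs : -1 < 1 / p - 2 := by
    have : 1 < 1 / p := by rw [lt_div_iff₀ hp0]; linarith
    linarith
  have hZ : ∀ f, ZNorm p f = ZN (1 / p - 2) f := fun f => rfl
  have hmem : ∀ f, MemZ p f ↔ f ∈ Zsub (1 / p - 2) := fun f => Iff.rfl
  generalize 1 / p - 2 = s at hs hZ hmem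
  obtain ⟨A, B, K, hK, hA, hB, hBA⟩ := coretract hs
  obtain ⟨A2, B2, K2, hK2, hA2, hB2, hAB2⟩ := retract hs
  have nadd : ∀ x y : Zsub s, (ZN s (x + y).1).toReal ≤ (ZN s x.1).toReal + (ZN s y.1).toReal := by
    intro x y
    rw [← ENNReal.toReal_add x.2.2.ne y.2.2.ne]
    exact ENNReal.toReal_mono (ENNReal.add_lt_top.2 ⟨x.2.2, y.2.2⟩).ne (ZN_add s x.2.1)
  have nneg : ∀ y : Zsub s, ZN s (-y).1 = ZN s y.1 := by
    intro y
    simp [ZN]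
  have mono : ∀ {a b c d : ℝ}, 0 ≤ c → 0 ≤ d → a ≤ b * c → a ≤ (b + d) * c := by
    intro a b c d hc hd h
    nlinarith [mul_nonneg hd hc]
  obtain ⟨T, C, hC, hinj, hsurj, hbd⟩ := pelczynski (V := Zsub s) (fun x => (ZN s x.1).toReal)
    (fun x => ENNReal.toReal_nonneg) nadd
    (fun x y => by
      have := nadd x (-y)
      rw [nneg] at this
      rwa [sub_eq_add_neg])
    A B A2 B2 (K + K2) (add_nonneg hK hK2)
    (fun x => mono ENNReal.toReal_nonneg hK2 (hA x))
    (fun x => by rw [add_comm]; exact mono ENNReal.toReal_nonneg hK (hA2 x))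
    (fun x => mono (norm_nonneg _) hK2 (hB x))
    (fun x => by rw [add_comm]; exact mono (norm_nonneg _) hK (hB2 x))
    hBA hAB2
  obtain ⟨T2, hT2⟩ := LinearMap.exists_extend T
  have hT : ∀ f : Zsub s, T2 f.1 = T f := fun f => by rw [← hT2]; rfl
  refine ⟨T2, C, hC, ?_, ?_, ?_⟩
  · intro f hf g hg hfg
    have hf1 : f ∈ Zsub s := (hmem f).1 hf
    have hg1 : g ∈ Zsub s := (hmem g).1 hg
    have e1 := hT ⟨f, hf1⟩
    have e2 := hT ⟨g, hg1⟩
    have := hinj (e1.symm.trans (hfg.trans e2))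
    exact congrArg Subtype.val this
  · intro a ha
    obtain ⟨f, hf⟩ := hsurj a ha
    exact ⟨f.1, (hmem _).2 f.2, (hT f).trans hf⟩
  · intro f hf
    have hf1 : f ∈ Zsub s := (hmem f).1 hf
    have e1 : T2 f = T ⟨f, hf1⟩ := hT ⟨f, hf1⟩
    obtain ⟨h1, h2, h3⟩ := hbd ⟨f, hf1⟩
    rw [e1, hZ]
    refine ⟨h1, ?_, h3⟩
    rw [inv_mul_le_iff₀ hC]
    exact h2
end
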